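/- arXiv:0904.3167 — 2 statements merged into one kernel-verified Lean document; each statement's English description precedes it below -/
import Mathlib

section
/- Let S be an affine scheme, let n ≥ 1, and let X → S be a morphism of finite presentation of type (FA)_n. Then there exists a scheme S₀ of finite type over Spec ℤ, a morphism S → S₀, and an S₀-scheme X₀ of finite presentation of type (FA)_n over S₀, such that X is isomorphic as an S-scheme to the fibre product X₀ ×_{S₀} S. -/
open AlgebraicGeometry CategoryTheory Limits

universe u

/-- A morphism of schemes `f : X ⟶ S` is of type (FA)ₙ if every `n` points of
`X` whose images lie in a common affine open subset of `S` lie in a common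
affine open subset of `X`. -/
def IsFA (n : ℕ) {X S : Scheme.{u}} (f : X ⟶ S) : Prop :=
  ∀ pts : Fin n → X,
    (∃ U : S.Opens, IsAffineOpen U ∧ ∀ j, f.base (pts j) ∈ U) →
    ∃ V : X.Opens, IsAffineOpen V ∧ ∀ j, pts j ∈ V

section
open AlgebraicGeometry CategoryTheory Limits

def FAspace (n : ℕ) (X : Scheme.{u}) : Prop :=
  ∀ pts : Fin n → X, ∃ V : X.Opens, IsAffineOpen V ∧ ∀ j, pts j ∈ V

/-- combinatorial criterion -/
lemma faspace_of_cover {n : ℕ} {X : Scheme.{u}} {K : Type*} (U : K → X.Opens)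
    (hU : ∀ k, IsAffineOpen (U k))
    (H : ∀ φ : K → Fin n, ∃ j, ⨆ k : {k // φ k = j}, U k = ⊤) : FAspace n X := by
  intro pts
  by_contra! h
  choose φ hφ using fun k ↦ h (U k) (hU k)
  obtain ⟨j, hj⟩ := H φ
  have : pts j ∈ ⨆ k : {k // φ k = j}, U k := hj ▸ trivial
  obtain ⟨⟨k, rfl⟩, hk⟩ := TopologicalSpace.Opens.mem_iSup.mp this
  exact hφ k hk

lemma FAspace.exists_cover {n : ℕ} (hn1 : 1 ≤ n) {X : Scheme.{u}} [CompactSpace X] (h : FAspace n X) :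
    ∃ s : Finset X.affineOpens, ∀ φ : s → Fin n, ∃ j, ⨆ k : {k // φ k = j}, (k.1.1 : X.Opens) = ⊤ := by
  classical
  -- every coloring of all affine opens has a finite monochromatic cover
  have key : ∀ φ : X.affineOpens → Fin n, ∃ (j : Fin n) (t : Finset X.affineOpens),
      (∀ k ∈ t, φ k = j) ∧ (⨆ k : t, (k.1 : X.Opens)) = ⊤ := by
    intro φ
    obtain ⟨j, hj⟩ : ∃ j, (⨆ k : {k // φ k = j}, (k.1 : X.Opens)) = ⊤ := by
      by_contra! hne
      have : ∀ j, ∃ x : X, x ∉ (⨆ k : {k // φ k = j}, (k.1 : X.Opens)) := by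
        intro j
        by_contra! hx
        exact hne j (top_le_iff.mp fun x _ ↦ hx x)
      choose pts hpts using this
      obtain ⟨V, hV, hV'⟩ := h pts
      exact hpts (φ ⟨V, hV⟩) (TopologicalSpace.Opens.mem_iSup.mpr ⟨⟨⟨V, hV⟩, rfl⟩, hV' _⟩)
    obtain ⟨t, ht⟩ := isCompact_univ.elim_finite_subcover
      (fun k : {k // φ k = j} ↦ ((k.1 : X.Opens) : Set X)) (fun k ↦ (k.1 : X.Opens).isOpen)
      (fun x _ ↦ by
        have : x ∈ (⨆ k : {k // φ k = j}, (k.1 : X.Opens)) := hj ▸ trivial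
        obtain ⟨k, hk⟩ := TopologicalSpace.Opens.mem_iSup.mp this
        exact Set.mem_iUnion.mpr ⟨k, hk⟩)
    refine ⟨j, t.image Subtype.val, ?_, ?_⟩
    · intro k hk
      obtain ⟨k', _, rfl⟩ := Finset.mem_image.mp hk
      exact k'.2
    · refine top_le_iff.mp fun x _ ↦ ?_
      obtain ⟨k, hk, hxk⟩ := Set.mem_iUnion₂.mp (ht (Set.mem_univ x))
      exact TopologicalSpace.Opens.mem_iSup.mpr ⟨⟨k.1, Finset.mem_image_of_mem _ hk⟩, hxk⟩
  choose c t ht1 ht2 using key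
  obtain ⟨T, hT⟩ := (isCompact_univ (X := X.affineOpens → Fin n)).elim_nhds_subcover
    (fun φ ↦ {ψ | ∀ k ∈ t φ, ψ k = φ k}) (by
      intro φ _
      refine IsOpen.mem_nhds ?_ (by simp)
      have : {ψ : X.affineOpens → Fin n | ∀ k ∈ t φ, ψ k = φ k} =
          ⋂ k ∈ t φ, (fun ψ ↦ ψ k) ⁻¹' {φ k} := by ext; simp
      rw [this]
      exact isOpen_biInter_finset fun k _ ↦ (isOpen_discrete _).preimage (continuous_apply k))
  refine ⟨T.biUnion t, fun φ ↦ ?_⟩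
  have hn : Nonempty (Fin n) := ⟨⟨0, hn1⟩⟩
  let φ' : X.affineOpens → Fin n := fun k ↦ if hk : k ∈ T.biUnion t then φ ⟨k, hk⟩ else hn.some
  obtain ⟨ψ, hψT, hψ⟩ := Set.mem_iUnion₂.mp (hT.2 (Set.mem_univ φ'))
  refine ⟨c ψ, top_le_iff.mp fun x hx ↦ ?_⟩
  rw [← ht2 ψ] at hx
  obtain ⟨⟨k, hk⟩, hxk⟩ := TopologicalSpace.Opens.mem_iSup.mp hx
  have hkT : k ∈ T.biUnion t := Finset.mem_biUnion.mpr ⟨ψ, hψT, hk⟩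
  refine TopologicalSpace.Opens.mem_iSup.mpr ⟨⟨⟨k, hkT⟩, ?_⟩, hxk⟩
  have h1 := hψ k hk
  rw [ht1 ψ k hk] at h1
  rw [← h1]
  simp only [φ', dif_pos hkT]

lemma exists_faspace_of_isLimit {J : Type u} [Category.{u} J] [IsCofiltered J] (D : J ⥤ Scheme.{u})
    (c : Cone D) (hc : IsLimit c) [∀ {i j} (f : i ⟶ j), IsAffineHom (D.map f)]
    [∀ i, CompactSpace (D.obj i)] [∀ i, QuasiSeparatedSpace (D.obj i)]
    (n : ℕ) (hn : 1 ≤ n) (h : FAspace n c.pt) : ∃ j, FAspace n (D.obj j) := by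
  classical
  have := Scheme.compactSpace_of_isLimit D c hc
  obtain ⟨s, hs⟩ := h.exists_cover hn
  choose i V hV hVi using fun k : s ↦ exists_isAffineOpen_preimage_eq D c hc k.1.1 k.1.2
  obtain ⟨i₀, fi⟩ := IsCofiltered.inf_objs_exists (Finset.univ.image i)
  replace fi : ∀ k, i₀ ⟶ i k := fun k ↦ (fi (by simp)).some
  choose j hj using hs
  have := fun φ ↦ exists_map_eq_top D c hc (⨆ k : {k // φ k = j φ}, D.map (fi k) ⁻¹ᵁ V k) (by
    rw [← hj φ, Scheme.Hom.preimage_iSup]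
    simp_rw [← Scheme.Hom.comp_preimage, c.w, hVi])
  choose l g hg using this
  obtain ⟨m, hm1, hm2⟩ := IsCofiltered.inf_exists (insert i₀ (Finset.univ.image l))
    (Finset.univ.image fun φ ↦ ⟨l φ, i₀, by simp, by simp, g φ⟩)
  refine ⟨m, faspace_of_cover (fun k ↦ D.map (hm1 (X := i₀) (by simp) ≫ fi k) ⁻¹ᵁ V k)
    (fun k ↦ (hV k).preimage _) fun φ ↦ ⟨j φ, ?_⟩⟩
  have e := hm2 (X := l φ) (Y := i₀) (by simp) (by simp) (f := g φ)
    (Finset.mem_image_of_mem _ (Finset.mem_univ φ))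
  have h2 := congr(D.map (hm1 (X := l φ) (by simp)) ⁻¹ᵁ $(hg φ))
  rw [← Scheme.Hom.comp_preimage, ← D.map_comp, e, Scheme.Hom.preimage_iSup] at h2
  simp_rw [← Scheme.Hom.comp_preimage, ← D.map_comp] at h2
  simpa using h2
end

section
open AlgebraicGeometry CategoryTheory Limits

section Model
variable {I : Type u} [Category.{u} I] {D : I ⥤ Scheme.{u}} {c : Cone D}

noncomputable def bcDiag {i : I} {P : Scheme.{u}} (p : P ⟶ D.obj i) : Over i ⥤ Scheme.{u} where
  obj j := pullback (D.map j.hom) p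
  map {j k} g := pullback.lift (pullback.fst _ _ ≫ D.map g.left) (pullback.snd _ _) (by
    rw [Category.assoc, ← D.map_comp, Over.w g, pullback.condition])
  map_id j := by apply pullback.hom_ext <;> simp
  map_comp f g := by
    apply pullback.hom_ext
    · rw [pullback.lift_fst, Category.assoc, pullback.lift_fst, pullback.lift_fst_assoc]
      simp
    · rw [pullback.lift_snd, Category.assoc, pullback.lift_snd, pullback.lift_snd]

variable {i : I} {P Y : Scheme.{u}} {p : P ⟶ D.obj i} {h : Y ⟶ P} {f : Y ⟶ c.pt}

noncomputable def bcF (p : P ⟶ D.obj i) (j : Over i) : (bcDiag p).obj j ⟶ D.obj j.left :=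
  pullback.fst (D.map j.hom) p

noncomputable def bcS (p : P ⟶ D.obj i) (j : Over i) : (bcDiag p).obj j ⟶ P :=
  pullback.snd (D.map j.hom) p

lemma bc_isPullback (p : P ⟶ D.obj i) (j : Over i) :
    IsPullback (bcS p j) (bcF p j) p (D.map j.hom) :=
  (IsPullback.of_hasPullback _ _).flip

@[simp]
lemma bcDiag_map_F {j k : Over i} (g : j ⟶ k) :
    (bcDiag p).map g ≫ bcF p k = bcF p j ≫ D.map g.left :=
  pullback.lift_fst _ _ _

@[simp]
lemma bcDiag_map_S {j k : Over i} (g : j ⟶ k) :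
    (bcDiag p).map g ≫ bcS p k = bcS p j :=
  pullback.lift_snd _ _ _

noncomputable def bcFst (p : P ⟶ D.obj i) : bcDiag p ⟶ Over.forget i ⋙ D where
  app j := bcF p j
  naturality _ _ g := bcDiag_map_F g

noncomputable def bcSnd (p : P ⟶ D.obj i) : bcDiag p ⟶ (Functor.const _).obj P where
  app j := bcS p j
  naturality _ _ g := (bcDiag_map_S g).trans (Category.comp_id _).symm

noncomputable def bcπ (H : IsPullback h f p (c.π.app i)) (j : Over i) : Y ⟶ (bcDiag p).obj j :=
  (bc_isPullback p j).lift h (f ≫ c.π.app j.left) (by simp [H.w])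

lemma bcπ_F (H : IsPullback h f p (c.π.app i)) (j : Over i) :
    bcπ H j ≫ bcF p j = f ≫ c.π.app j.left :=
  (bc_isPullback p j).lift_snd _ _ _

lemma bcπ_S (H : IsPullback h f p (c.π.app i)) (j : Over i) :
    bcπ H j ≫ bcS p j = h :=
  (bc_isPullback p j).lift_fst _ _ _

lemma bcπ_map (H : IsPullback h f p (c.π.app i)) {j k : Over i} (g : j ⟶ k) :
    bcπ H j ≫ (bcDiag p).map g = bcπ H k := by
  apply (bc_isPullback p k).hom_ext
  · simp only [Category.assoc, bcDiag_map_S, bcπ_S]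
  · rw [Category.assoc, bcDiag_map_F, bcπ_F, ← Category.assoc, bcπ_F, Category.assoc, c.w]

noncomputable def bcCone (H : IsPullback h f p (c.π.app i)) : Cone (bcDiag (D := D) p) where
  pt := Y
  π :=
  { app j := bcπ H j
    naturality _ _ g := (Category.id_comp _).trans (bcπ_map H g).symm }

lemma bcπ_isPullback (H : IsPullback h f p (c.π.app i)) (j : Over i) :
    IsPullback (bcπ H j) f (bcF p j) (c.π.app j.left) := by
  refine IsPullback.of_right (h₁₂ := bcS p j) (v₁₃ := p) (h₂₂ := D.map j.hom) ?_
    (bcπ_F H j) (bc_isPullback p j)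
  rw [c.w]
  exact (bcπ_S H j).symm ▸ H

lemma bcCone_isPullback (H : IsPullback h f p (c.π.app i)) (j : Over i) :
    IsPullback ((bcCone H).π.app j) f (bcF p j) (c.π.app j.left) := bcπ_isPullback H j

attribute [local instance] CategoryTheory.isConnected_of_hasTerminal

noncomputable def bcIsLimit [IsCofiltered I] (hc : IsLimit c) (H : IsPullback h f p (c.π.app i)) :
    IsLimit (bcCone H) :=
  isLimitOfIsPullbackOfIsConnected (bcFst p) _ _
    (by exact { hom := f, w := fun j ↦ (bcπ_F H j).symm })
    (fun j ↦ (bcCone_isPullback H j))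
    ((Functor.Initial.isLimitWhiskerEquiv (Over.forget i) c).symm hc)

lemma bcDiag_isPullback {j k : Over i} (g : j ⟶ k) :
    IsPullback ((bcDiag p).map g) (bcF p j) (bcF p k) (D.map g.left) := by
  refine IsPullback.of_right (h₁₂ := bcS p k) (v₁₃ := p) (h₂₂ := D.map k.hom) ?_
    (bcDiag_map_F g) (bc_isPullback p k)
  rw [bcDiag_map_S, ← D.map_comp, Over.w]
  exact bc_isPullback p j

instance [∀ {i j} (f : i ⟶ j), IsAffineHom (D.map f)] {j k : Over i} (g : j ⟶ k) :
    IsAffineHom ((bcDiag p).map g) := 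
  MorphismProperty.of_isPullback (P := @IsAffineHom) (bcDiag_isPullback g).flip inferInstance

instance [QuasiCompact p] (j : Over i) : QuasiCompact (bcF p j) :=
  MorphismProperty.of_isPullback (P := @QuasiCompact) (bc_isPullback p j) inferInstance

instance [QuasiSeparated p] (j : Over i) : QuasiSeparated (bcF p j) :=
  MorphismProperty.of_isPullback (P := @QuasiSeparated) (bc_isPullback p j) inferInstance

instance [LocallyOfFinitePresentation p] (j : Over i) : LocallyOfFinitePresentation (bcF p j) :=
  MorphismProperty.of_isPullback (P := @LocallyOfFinitePresentation) (bc_isPullback p j) inferInstance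

instance [∀ i, IsAffine (D.obj i)] [QuasiCompact p] (j : Over i) :
    CompactSpace ((bcDiag p).obj j) := 
  QuasiCompact.compactSpace_of_compactSpace (bcF p j)

instance [∀ i, IsAffine (D.obj i)] [QuasiSeparated p] (j : Over i) :
    QuasiSeparatedSpace ((bcDiag p).obj j) := 
  quasiSeparatedSpace_of_quasiSeparated (bcF p j)

end Model
end

section
open AlgebraicGeometry CategoryTheory Limits

set_option linter.unusedSectionVars false
section Iso
variable {I : Type u} [Category.{u} I] [IsCofiltered I] {D : I ⥤ Scheme.{u}} {c : Cone D}
  [∀ i, IsAffine (D.obj i)]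
  {i : I} {P Q Y : Scheme.{u}} {p : P ⟶ D.obj i} {h : Y ⟶ P} {f : Y ⟶ c.pt}

lemma model_exists (hc : IsLimit c) (H : IsPullback h f p (c.π.app i))
    [QuasiCompact p] [QuasiSeparated p] (q : Q ⟶ D.obj i) [LocallyOfFinitePresentation q]
    (a : Y ⟶ Q) (ha : a ≫ q = f ≫ c.π.app i) :
    ∃ (j : Over i) (g : (bcDiag p).obj j ⟶ Q), bcπ H j ≫ g = a ∧
      g ≫ q = bcS p j ≫ p := by
  obtain ⟨j, g, h1, h2⟩ := Scheme.exists_π_app_comp_eq_of_locallyOfFinitePresentation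
    (bcDiag p) (bcSnd p ≫ (Functor.const _).map p) q (bcCone H) (bcIsLimit hc H) a (by
      ext j : 2
      change bcπ H j ≫ (bcS p j ≫ p) = a ≫ q
      rw [← Category.assoc, bcπ_S, H.w, ← ha])
  exact ⟨j, g, h1, h2⟩

lemma model_unique (hc : IsLimit c) (H : IsPullback h f p (c.π.app i))
    [QuasiCompact p] [QuasiSeparated p] (q : Q ⟶ D.obj i) [LocallyOfFiniteType q]
    {j : Over i}
    (a b : (bcDiag p).obj j ⟶ Q) (ha : a ≫ q = bcS p j ≫ p) (hb : b ≫ q = bcS p j ≫ p)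
    (hab : bcπ H j ≫ a = bcπ H j ≫ b) :
    ∃ (k : Over i) (φ : k ⟶ j), (bcDiag p).map φ ≫ a = (bcDiag p).map φ ≫ b :=
  Scheme.exists_hom_comp_eq_comp_of_locallyOfFiniteType
    (bcDiag p) (bcSnd p ≫ (Functor.const _).map p) q (bcCone H) (bcIsLimit hc H) a b
    ha.symm hb.symm hab

variable {q : Q ⟶ D.obj i} {hQ : Y ⟶ Q}

/-- the base change of a morphism defined at some stage -/
noncomputable def bcMor {j : Over i} (G : (bcDiag p).obj j ⟶ Q) (w : G ≫ q = bcS p j ≫ p)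
    {m : Over i} (φ : m ⟶ j) : (bcDiag p).obj m ⟶ (bcDiag q).obj m :=
  (bc_isPullback q m).lift ((bcDiag p).map φ ≫ G) (bcF p m) (by
    rw [Category.assoc, w, ← Category.assoc, bcDiag_map_S, (bc_isPullback p m).w])

lemma bcMor_S {j : Over i} (G : (bcDiag p).obj j ⟶ Q) (w : G ≫ q = bcS p j ≫ p)
    {m : Over i} (φ : m ⟶ j) : bcMor G w φ ≫ bcS q m = (bcDiag p).map φ ≫ G :=
  (bc_isPullback q m).lift_fst _ _ _

lemma bcMor_F {j : Over i} (G : (bcDiag p).obj j ⟶ Q) (w : G ≫ q = bcS p j ≫ p)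
    {m : Over i} (φ : m ⟶ j) : bcMor G w φ ≫ bcF q m = bcF p m :=
  (bc_isPullback q m).lift_snd _ _ _

lemma bcMor_map {j : Over i} (G : (bcDiag p).obj j ⟶ Q) (w : G ≫ q = bcS p j ≫ p)
    {m : Over i} (φ : m ⟶ j) {m' : Over i} (ψ : m' ⟶ m) :
    bcMor G w (ψ ≫ φ) ≫ (bcDiag q).map ψ = (bcDiag p).map ψ ≫ bcMor G w φ := by
  apply (bc_isPullback q m).hom_ext
  · simp only [Category.assoc, bcDiag_map_S, bcMor_S, Functor.map_comp]
  · simp only [Category.assoc, bcDiag_map_F, bcMor_F]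
    rw [← Category.assoc, bcMor_F]

lemma bcMor_π (H : IsPullback h f p (c.π.app i)) (H' : IsPullback hQ f q (c.π.app i))
    {j : Over i} (G : (bcDiag p).obj j ⟶ Q) (w : G ≫ q = bcS p j ≫ p)
    (hG : bcπ H j ≫ G = hQ)
    {m : Over i} (φ : m ⟶ j) : bcπ H m ≫ bcMor G w φ = bcπ H' m := by
  apply (bc_isPullback q m).hom_ext
  · rw [Category.assoc, bcMor_S, bcπ_S, ← Category.assoc, bcπ_map, hG]
  · rw [Category.assoc, bcMor_F, bcπ_F, bcπ_F]

lemma bcMor_comp_aux (hc : IsLimit c) (H : IsPullback h f p (c.π.app i))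
    (H' : IsPullback hQ f q (c.π.app i)) [QuasiCompact p] [QuasiSeparated p]
    [LocallyOfFiniteType p]
    {j j' : Over i} (G : (bcDiag p).obj j ⟶ Q) (w : G ≫ q = bcS p j ≫ p)
    (hG : bcπ H j ≫ G = hQ)
    (G' : (bcDiag q).obj j' ⟶ P) (w' : G' ≫ p = bcS q j' ≫ q)
    (hG' : bcπ H' j' ≫ G' = h) {m : Over i} (φ : m ⟶ j) (φ' : m ⟶ j') :
    ∃ (k : Over i) (ψ : k ⟶ m), ∀ (l : Over i) (χ : l ⟶ k),
      bcMor G w (χ ≫ ψ ≫ φ) ≫ bcMor G' w' (χ ≫ ψ ≫ φ') = 𝟙 _ := by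
  obtain ⟨k, ψ, e⟩ := model_unique hc H p (bcMor G w φ ≫ bcMor G' w' φ' ≫ bcS p m) (bcS p m)
    (by
      rw [Category.assoc, Category.assoc, (bc_isPullback p m).w, ← Category.assoc (bcMor G' w' φ'),
        bcMor_F, ← Category.assoc, bcMor_F]) rfl
    (by rw [← Category.assoc, bcMor_π H H' G w hG, ← Category.assoc, bcMor_π H' H G' w' hG'])
  refine ⟨k, ψ, fun l χ ↦ ?_⟩
  rw [← Category.assoc, ← Category.assoc]
  apply (bc_isPullback p l).hom_ext
  · rw [Category.id_comp, ← bcDiag_map_S (χ ≫ ψ), Category.assoc, 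
      ← Category.assoc (bcMor G' w' _) ((bcDiag p).map _), bcMor_map, ← Category.assoc,
      ← Category.assoc, bcMor_map, Functor.map_comp]
    simp only [Category.assoc]
    rw [e]
  · rw [Category.assoc, bcMor_F, bcMor_F, Category.id_comp]

lemma model_iso (hc : IsLimit c) (H : IsPullback h f p (c.π.app i))
    (H' : IsPullback hQ f q (c.π.app i)) [QuasiCompact p] [QuasiSeparated p]
    [LocallyOfFinitePresentation p] [QuasiCompact q] [QuasiSeparated q]
    [LocallyOfFinitePresentation q] :
    ∃ (m : Over i) (e : (bcDiag p).obj m ≅ (bcDiag q).obj m), e.hom ≫ bcF q m = bcF p m ∧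
      bcπ H m ≫ e.hom = bcπ H' m := by
  obtain ⟨j, G, hG, w⟩ := model_exists hc H q hQ H'.w
  obtain ⟨j', G', hG', w'⟩ := model_exists hc H' p h H.w
  let m := IsCofiltered.min j j'
  let φ : m ⟶ j := IsCofiltered.minToLeft _ _
  let φ' : m ⟶ j' := IsCofiltered.minToRight _ _
  obtain ⟨k, ψ, e⟩ := bcMor_comp_aux hc H H' G w hG G' w' hG' φ φ'
  obtain ⟨k', ψ', e'⟩ := bcMor_comp_aux hc H' H G' w' hG' G w hG φ' φ
  obtain ⟨l, χ, χ', hχ⟩ := IsCofiltered.cospan ψ ψ'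
  refine ⟨l, ⟨bcMor G w (χ ≫ ψ ≫ φ), bcMor G' w' (χ ≫ ψ ≫ φ'), e l χ, ?_⟩, bcMor_F G w _,
    bcMor_π H H' G w hG _⟩
  rw [← Category.assoc, hχ, Category.assoc, ← Category.assoc χ, hχ, Category.assoc]
  exact e' l χ'
end Iso
end

section
open AlgebraicGeometry CategoryTheory Limits

section Glue

lemma isPullback_of_cover' {W X Y Z : Scheme.{u}} (fWX : W ⟶ X) (fWY : W ⟶ Y) (fXZ : X ⟶ Z)
    (fYZ : Y ⟶ Z) (𝒰 : X.OpenCover) (A : 𝒰.I₀ → Scheme.{u}) (a : ∀ i, A i ⟶ W)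
    (b : ∀ i, A i ⟶ 𝒰.X i) (h1 : ∀ i, IsPullback (a i) (b i) fWX (𝒰.f i))
    (h2 : ∀ i, IsPullback (b i) (a i ≫ fWY) (𝒰.f i ≫ fXZ) fYZ) :
    IsPullback fWX fWY fXZ fYZ := by
  refine Scheme.isPullback_of_openCover _ _ _ _ 𝒰 fun i ↦ ?_
  have e1 : (h1 i).isoPullback.inv ≫ a i = pullback.fst _ _ := (h1 i).isoPullback_inv_fst
  have e2 : (h1 i).isoPullback.inv ≫ b i = pullback.snd _ _ := (h1 i).isoPullback_inv_snd
  have : IsPullback (pullback.snd fWX (𝒰.f i)) (pullback.fst fWX (𝒰.f i) ≫ fWY)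
      (𝒰.f i ≫ fXZ) fYZ := by
    refine IsPullback.of_iso (h2 i) (h1 i).isoPullback (Iso.refl _) (Iso.refl _) (Iso.refl _)
      ?_ ?_ ?_ ?_
    · rw [Iso.refl_hom, Category.comp_id, ← Iso.inv_comp_eq, e2]
    · rw [Iso.refl_hom, Category.comp_id, ← Iso.inv_comp_eq, ← Category.assoc, e1]
    · simp
    · simp
  exact this

noncomputable def cover2 {V W X : Scheme.{u}} (a : V ⟶ X) (b : W ⟶ X) [IsOpenImmersion a]
    [IsOpenImmersion b] (hs : ∀ x : X, (∃ v, a v = x) ∨ ∃ w, b w = x) : X.OpenCover :=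
  Scheme.Cover.mkOfCovers (P := @IsOpenImmersion) Bool (fun i ↦ i.rec V W)
    (fun i ↦ match i with | false => a | true => b)
    (fun x ↦ by
      rcases hs x with ⟨v, hv⟩ | ⟨w, hw⟩
      · exact ⟨false, v, hv⟩
      · exact ⟨true, w, hw⟩)
    (fun i ↦ match i with | false => ‹_› | true => ‹_›)

variable {V W X Z : Scheme.{u}} (a : V ⟶ X) (b : W ⟶ X) [IsOpenImmersion a]
    [IsOpenImmersion b]

lemma glue2_ext (hs : ∀ x : X, (∃ v, a v = x) ∨ ∃ w, b w = x) {α β : X ⟶ Z} (h1 : a ≫ α = a ≫ β) (h2 : b ≫ α = b ≫ β) : α = β :=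
  Scheme.Cover.hom_ext (cover2 a b hs) _ _ (fun i ↦ match i with | false => h1 | true => h2)

lemma glue2_exists (hs : ∀ x : X, (∃ v, a v = x) ∨ ∃ w, b w = x) (α : V ⟶ Z) (β : W ⟶ Z)
    (w : pullback.fst a b ≫ α = pullback.snd a b ≫ β) : ∃ γ : X ⟶ Z, a ≫ γ = α ∧ b ≫ γ = β := by
  have key : ∀ x y, pullback.fst ((cover2 a b hs).f x) ((cover2 a b hs).f y) ≫
      (match x with | false => α | true => β : (cover2 a b hs).X x ⟶ Z) = pullback.snd _ _ ≫ 
      (match y with | false => α | true => β : (cover2 a b hs).X y ⟶ Z) := by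
    intro x y
    match x, y with
    | false, false => 
      have := (cancel_mono a).1 (pullback.condition (f := a) (g := a))
      exact congr($this ≫ α)
    | true, true => 
      have := (cancel_mono b).1 (pullback.condition (f := b) (g := b))
      exact congr($this ≫ β)
    | false, true => exact w
    | true, false => 
      have := congr((pullbackSymmetry b a).hom ≫ $w)
      rw [← Category.assoc, ← Category.assoc, pullbackSymmetry_hom_comp_fst,
        pullbackSymmetry_hom_comp_snd] at this
      exact this.symm
  exact ⟨Scheme.Cover.glueMorphisms (cover2 a b hs) _ key,
    Scheme.Cover.ι_glueMorphisms (cover2 a b hs) _ key false,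
    Scheme.Cover.ι_glueMorphisms (cover2 a b hs) _ key true⟩

lemma pushout_exists {R V W : Scheme.{u}} (rV : R ⟶ V) (rW : R ⟶ W) [IsOpenImmersion rV]
    [IsOpenImmersion rW] : ∃ (X : Scheme.{u}) (a : V ⟶ X) (b : W ⟶ X), IsOpenImmersion a ∧
    IsOpenImmersion b ∧ rV ≫ a = rW ≫ b ∧ (∀ x : X, (∃ v, a v = x) ∨ ∃ w, b w = x) ∧
    (∀ v w, a v = b w → ∃ r, rV r = v ∧ rW r = w) ∧
    ∀ (Z : Scheme.{u}) (α : V ⟶ Z) (β : W ⟶ Z), rV ≫ α = rW ≫ β →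
      ∃ γ : X ⟶ Z, a ≫ γ = α ∧ b ≫ γ = β := by
  have inst : ∀ {i j} (f : i ⟶ j), IsOpenImmersion ((span rV rW).map f) := by
    rintro i j (_ | (_ | _))
    · have := (span rV rW).map_id i
      exact this ▸ (inferInstance : IsOpenImmersion (𝟙 ((span rV rW).obj i)))
    · exact ‹IsOpenImmersion rV›
    · exact ‹IsOpenImmersion rW›
  refine ⟨pushout rV rW, pushout.inl rV rW, pushout.inr rV rW, ?_, ?_, pushout.condition,
    ?_, ?_, ?_⟩
  · exact inferInstanceAs (IsOpenImmersion (colimit.ι (span rV rW) _))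
  · exact inferInstanceAs (IsOpenImmersion (colimit.ι (span rV rW) _))
  · intro x
    obtain ⟨i, y, hy⟩ := Scheme.IsLocallyDirected.ι_jointly_surjective (span rV rW) x
    match i, y with
    | none, y => 
      refine Or.inl ⟨rV y, ?_⟩
      exact (congr(($(colimit.w (span rV rW) WalkingSpan.Hom.fst)) y) : _).trans hy
    | some .left, y => exact Or.inl ⟨y, hy⟩
    | some .right, y => exact Or.inr ⟨y, hy⟩
  · intro v w hvw
    obtain ⟨k, fi, fj, x, h1, h2⟩ := (Scheme.IsLocallyDirected.ι_eq_ι_iff (span rV rW) 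
      (i := WalkingSpan.left) (j := WalkingSpan.right) (xi := v) (xj := w)).1 hvw
    match k, fi, fj, x, h1, h2 with
    | none, fi, fj, x, h1, h2 =>
      obtain rfl : fi = WalkingSpan.Hom.fst := Subsingleton.elim _ _
      obtain rfl : fj = WalkingSpan.Hom.snd := Subsingleton.elim _ _
      exact ⟨x, h1, h2⟩
    | some .left, fi, fj, x, h1, h2 => exact nomatch fj
    | some .right, fi, fj, x, h1, h2 => exact nomatch fi
  · intro Z α β w
    exact ⟨pushout.desc α β w, pushout.inl_desc _ _ _, pushout.inr_desc _ _ _⟩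
end Glue
end

section
open AlgebraicGeometry CategoryTheory Limits

section Glue2

lemma glue_pb_aux {R V V' W W' X X' : Scheme.{u}} (a : V ⟶ X) (b : W ⟶ X) [IsOpenImmersion a]
    (hs : ∀ x : X, (∃ v, a v = x) ∨ ∃ w, b w = x) (rV : R ⟶ V') (rW : R ⟶ W')
    (a' : V' ⟶ X') (b' : W' ⟶ X') [IsOpenImmersion a']
    (hR : ∀ v w, a' v = b' w → ∃ r, rV r = v ∧ rW r = w) {O : Scheme.{u}} (oV : O ⟶ V)
    (oW : O ⟶ W) (ho : oV ≫ a = oW ≫ b) (hO : O ⟶ R) (hV : V ⟶ V') (hW : W ⟶ W')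
    (HO : IsPullback hO oW rW hW)
    (h : X ⟶ X') (e1 : a ≫ h = hV ≫ a') (e2 : b ≫ h = hW ≫ b') :
    IsPullback a hV h a' := by
  refine (IsOpenImmersion.isPullback hV a a' h e1 ?_).flip
  ext x
  constructor
  · rintro ⟨v1, hv1⟩
    rcases hs x with ⟨v, hv⟩ | ⟨w, hw⟩
    · exact ⟨v, hv⟩
    · have : h x = b' (hW w) := by
        rw [← Scheme.Hom.comp_apply, ← e2, Scheme.Hom.comp_apply, hw]
      obtain ⟨r, hr1, hr2⟩ := hR v1 (hW w) (hv1.trans this)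
      obtain ⟨o, ho1, ho2⟩ := Scheme.exists_preimage_of_isPullback HO r w hr2
      refine ⟨oV o, ?_⟩
      rw [← hw, ← ho2]
      exact congr($ho o)
  · rintro ⟨v, hv⟩
    refine ⟨hV v, ?_⟩
    rw [← hv]
    exact congr($e1 v).symm

lemma glue_models {V W X T B V' W' R O : Scheme.{u}} (a : V ⟶ X) (b : W ⟶ X) [IsOpenImmersion a]
    [IsOpenImmersion b] (hs : ∀ x : X, (∃ v, a v = x) ∨ ∃ w, b w = x)
    (f : X ⟶ T) (t : T ⟶ B) (v' : V' ⟶ B) (w' : W' ⟶ B) (rV : R ⟶ V') (rW : R ⟶ W')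
    [IsOpenImmersion rV] [IsOpenImmersion rW] (hr : rV ≫ v' = rW ≫ w')
    (hV : V ⟶ V') (HV : IsPullback hV (a ≫ f) v' t)
    (hW : W ⟶ W') (HW : IsPullback hW (b ≫ f) w' t)
    (oV : O ⟶ V) (oW : O ⟶ W) (ho : IsPullback oV oW a b) (hO : O ⟶ R)
    (HO1 : IsPullback hO oV rV hV) (HO2 : IsPullback hO oW rW hW) :
    ∃ (X' : Scheme.{u}) (f' : X' ⟶ B) (h : X ⟶ X') (a' : V' ⟶ X') (b' : W' ⟶ X'),
      IsOpenImmersion a' ∧ IsOpenImmersion b' ∧ (∀ x : X', (∃ v, a' v = x) ∨ ∃ w, b' w = x) ∧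
      a' ≫ f' = v' ∧ b' ≫ f' = w' ∧ IsPullback h f f' t := by
  obtain ⟨X', a', b', i1, i2, hw, hs', hR, hγ⟩ := pushout_exists rV rW
  obtain ⟨f', f1, f2⟩ := hγ B v' w' hr
  obtain ⟨h, h1, h2⟩ := glue2_exists a b hs (hV ≫ a') (hW ≫ b') (by
    rw [← cancel_epi ho.isoPullback.hom]
    simp only [← Category.assoc, IsPullback.isoPullback_hom_fst, IsPullback.isoPullback_hom_snd,
      ← HO1.w, ← HO2.w]
    simp only [Category.assoc, hw])
  refine ⟨X', f', h, a', b', i1, i2, hs', f1, f2, ?_⟩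
  refine isPullback_of_cover' _ _ _ _ (cover2 a' b' hs') 
    (fun i ↦ i.rec V W) (fun i ↦ match i with | false => a | true => b)
    (fun i ↦ match i with | false => hV | true => hW)
    (fun i ↦ match i with 
      | false => ?_ 
      | true => ?_)
    (fun i ↦ match i with 
      | false => ?_ 
      | true => ?_)
  · exact glue_pb_aux a b hs rV rW a' b' hR oV oW ho.w hO hV hW HO2 h h1 h2
  · exact glue_pb_aux b a (fun x ↦ (hs x).symm) rW rV b' a' 
      (fun v w e ↦ by obtain ⟨r, r1, r2⟩ := hR w v e.symm; exact ⟨r, r2, r1⟩)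
       oW oV ho.w.symm hO hW hV HO1 h h2 h1
  · exact f1.symm ▸ HV
  · exact f2.symm ▸ HW

end Glue2
end

section
open AlgebraicGeometry CategoryTheory Limits

set_option linter.unusedSectionVars false

section Glue3

lemma qs_of_noeth {P B : Scheme.{u}} (p : P ⟶ B) [IsLocallyNoetherian B] [LocallyOfFiniteType p] :
    QuasiSeparated p := by
  have := LocallyOfFiniteType.isLocallyNoetherian p
  infer_instance

variable {I : Type u} [Category.{u} I] [IsCofiltered I] {D : I ⥤ Scheme.{u}} {c : Cone D}
  [∀ i, IsAffine (D.obj i)] [∀ i, IsLocallyNoetherian (D.obj i)]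

def HasModel (c : Cone D) {Y : Scheme.{u}} (f : Y ⟶ c.pt) : Prop :=
  ∃ (i : I) (P : Scheme.{u}) (p : P ⟶ D.obj i) (h : Y ⟶ P), LocallyOfFinitePresentation p ∧
    QuasiCompact p ∧ IsPullback h f p (c.π.app i)

def PairM (c : Cone D) {O V : Scheme.{u}} (o : O ⟶ V) (f : V ⟶ c.pt) (k : I) : Prop :=
  ∃ (V₀ P : Scheme.{u}) (v₀ : V₀ ⟶ D.obj k) (ι : P ⟶ V₀) (h : V ⟶ V₀) (hP : O ⟶ P),
    LocallyOfFinitePresentation v₀ ∧ QuasiCompact v₀ ∧ IsOpenImmersion ι ∧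
    IsPullback h f v₀ (c.π.app k) ∧ IsPullback hP o ι h

noncomputable def bcOpen {i : I} {V₀ P : Scheme.{u}} (ι : P ⟶ V₀) (v₀ : V₀ ⟶ D.obj i)
    (m : Over i) : (bcDiag (ι ≫ v₀)).obj m ⟶ (bcDiag v₀).obj m :=
  (bc_isPullback v₀ m).lift (bcS (ι ≫ v₀) m ≫ ι) (bcF (ι ≫ v₀) m)
    (by rw [Category.assoc, (bc_isPullback (ι ≫ v₀) m).w])

variable {i : I} {V₀ P : Scheme.{u}} (ι : P ⟶ V₀) (v₀ : V₀ ⟶ D.obj i) (m : Over i)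

lemma bcOpen_S : bcOpen ι v₀ m ≫ bcS v₀ m = bcS (ι ≫ v₀) m ≫ ι :=
  (bc_isPullback v₀ m).lift_fst _ _ _

lemma bcOpen_F : bcOpen ι v₀ m ≫ bcF v₀ m = bcF (ι ≫ v₀) m :=
  (bc_isPullback v₀ m).lift_snd _ _ _

lemma bcOpen_isPullback : IsPullback (bcS (ι ≫ v₀) m) (bcOpen ι v₀ m) ι (bcS v₀ m) := by
  refine IsPullback.of_bot (v₂₁ := bcF v₀ m) (v₂₂ := v₀) (h₃₁ := D.map m.hom) ?_
    (bcOpen_S ι v₀ m).symm (bc_isPullback v₀ m)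
  rw [bcOpen_F]
  exact bc_isPullback _ _

instance [IsOpenImmersion ι] : IsOpenImmersion (bcOpen ι v₀ m) :=
  MorphismProperty.of_isPullback (P := @IsOpenImmersion) (bcOpen_isPullback ι v₀ m) inferInstance

variable {ι v₀} {O V : Scheme.{u}} {o : O ⟶ V} {f : V ⟶ c.pt} {h : V ⟶ V₀} {hP : O ⟶ P}
variable (H1 : IsPullback h f v₀ (c.π.app i)) (H2 : IsPullback hP o ι h)

lemma pair_paste (H1 : IsPullback h f v₀ (c.π.app i)) (H2 : IsPullback hP o ι h) : IsPullback hP (o ≫ f) (ι ≫ v₀) (c.π.app i) := H2.paste_vert H1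

lemma pair_bc : IsPullback (bcπ (pair_paste H1 H2) m) o (bcOpen ι v₀ m) (bcπ H1 m) := by
  refine IsPullback.of_right (h₁₂ := bcS (ι ≫ v₀) m) (v₁₃ := ι) (h₂₂ := bcS v₀ m) ?_ ?_
    (bcOpen_isPullback ι v₀ m)
  · rw [bcπ_S, bcπ_S]; exact H2
  · apply (bc_isPullback v₀ m).hom_ext
    · rw [Category.assoc, bcOpen_S, ← Category.assoc, bcπ_S, Category.assoc, bcπ_S, H2.w]
    · rw [Category.assoc, bcOpen_F, bcπ_F, Category.assoc, Category.assoc, bcπ_F]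

lemma PairM.bc {k l : I} {O V : Scheme.{u}} {o : O ⟶ V} {f : V ⟶ c.pt} (h : PairM c o f k)
    (φ : l ⟶ k) : PairM c o f l := by
  obtain ⟨V₀, P, v₀, ι, h, hP, h1, h2, h3, h4, h5⟩ := h
  exact ⟨_, _, bcF v₀ (Over.mk φ), bcOpen ι v₀ (Over.mk φ), bcπ h4 _, bcπ (pair_paste h4 h5) _,
    inferInstance, inferInstance, inferInstance, bcπ_isPullback h4 (Over.mk φ), 
    pair_bc _ h4 h5⟩

lemma PairM.of_hasModel (hc : IsLimit c) {O V : Scheme.{u}} (o : O ⟶ V) [IsOpenImmersion o]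
    [CompactSpace O] {f : V ⟶ c.pt} (h : HasModel c f) : ∃ k, PairM c o f k := by
  obtain ⟨i, P, p, h, h1, h2, H⟩ := h
  obtain ⟨j, U, -, hU⟩ := exists_preimage_eq (bcDiag p) (bcCone H) (bcIsLimit hc H)
    o.opensRange (isCompact_range o.continuous)
  replace hU : bcπ H j ⁻¹ᵁ U = o.opensRange := hU
  refine ⟨j.left, _, _, bcF p j, U.ι, bcπ H j, IsOpenImmersion.lift U.ι (o ≫ bcπ H j) ?_,
    inferInstance, inferInstance, inferInstance, bcπ_isPullback H j,
    IsOpenImmersion.isPullback _ _ _ _ ?_ ?_⟩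
  · rintro _ ⟨x, rfl⟩
    have : o x ∈ o.opensRange := ⟨x, rfl⟩
    rw [← hU] at this
    simpa using this
  · exact (IsOpenImmersion.lift_fac _ _ _).symm
  · rw [← hU]; simp

lemma HasModel.glue (hc : IsLimit c) {V W X O : Scheme.{u}} (a : V ⟶ X) (b : W ⟶ X)
    [IsOpenImmersion a] [IsOpenImmersion b] (hs : ∀ x : X, (∃ v, a v = x) ∨ ∃ w, b w = x)
    (f : X ⟶ c.pt) (oV : O ⟶ V) (oW : O ⟶ W) [IsOpenImmersion oV] [IsOpenImmersion oW]
    [CompactSpace O] (ho : IsPullback oV oW a b) (hV : HasModel c (a ≫ f))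
    (hW : HasModel c (b ≫ f)) : HasModel c f := by
  obtain ⟨k1, hk1⟩ := PairM.of_hasModel hc oV hV
  obtain ⟨k2, hk2⟩ := PairM.of_hasModel hc oW hW
  obtain ⟨V₀, P, v₀, ι, h, hP, _, _, _, HV, HP⟩ := hk1.bc (IsCofiltered.minToLeft k1 k2)
  obtain ⟨W₀, Q, w₀, κ, h', hQ, _, _, _, HW, HQ⟩ := hk2.bc (IsCofiltered.minToRight k1 k2)
  generalize IsCofiltered.min k1 k2 = k at *
  have nV := LocallyOfFiniteType.isLocallyNoetherian v₀
  have nW := LocallyOfFiniteType.isLocallyNoetherian w₀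
  have q1 := qs_of_noeth (ι ≫ v₀)
  have q2 := qs_of_noeth (κ ≫ w₀)
  have HQ' : IsPullback hQ (oV ≫ a ≫ f) (κ ≫ w₀) (c.π.app k) := by
    rw [← Category.assoc, ho.w, Category.assoc]; exact pair_paste HW HQ
  obtain ⟨m, e, he1, he2⟩ := model_iso hc (pair_paste HV HP) HQ'
  have he2' : bcπ (pair_paste HV HP) m ≫ e.hom = bcπ (pair_paste HW HQ) m := by
    rw [he2]
    apply (bc_isPullback _ m).hom_ext
    · rw [bcπ_S, bcπ_S]
    · rw [bcπ_F, bcπ_F, ← Category.assoc oV, ho.w, Category.assoc oW]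
  obtain ⟨X', f', hX, a', b', i1, i2, hs', e1, e2, H⟩ := glue_models a b hs f (c.π.app m.left)
    (bcF v₀ m) (bcF w₀ m) (bcOpen ι v₀ m) (e.hom ≫ bcOpen κ w₀ m)
    (by rw [bcOpen_F, Category.assoc, bcOpen_F, he1]) (bcπ HV m) (bcπ_isPullback HV m)
    (bcπ HW m) (bcπ_isPullback HW m) oV oW ho (bcπ (pair_paste HV HP) m) (pair_bc m HV HP)
    (by
      refine IsPullback.of_iso (pair_bc m HW HQ) (Iso.refl _) e.symm (Iso.refl _) (Iso.refl _)
        ?_ ?_ ?_ ?_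
      · rw [← he2']; simp
      · simp
      · simp
      · simp)
  refine ⟨m.left, X', f', hX, ?_, ?_, H⟩
  · have hloc : IsZariskiLocalAtSource @LocallyOfFinitePresentation.{u} :=
      HasRingHomProperty.instIsZariskiLocalAtSource (Q := RingHom.FinitePresentation)
    rw [IsZariskiLocalAtSource.iff_of_openCover (P := @LocallyOfFinitePresentation)
      (cover2 a' b' hs')]
    intro i
    match i with
    | false => exact e1.symm ▸ (inferInstance : LocallyOfFinitePresentation (bcF v₀ m))
    | true => exact e2.symm ▸ (inferInstance : LocallyOfFinitePresentation (bcF w₀ m))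
  · have : CompactSpace X' := by
      constructor
      have := (isCompact_range a'.continuous).union (isCompact_range b'.continuous)
      convert this
      ext x
      simpa using hs' x
    infer_instance
end Glue3
end

section
open AlgebraicGeometry CategoryTheory Limits

noncomputable def adjF (A : Type u) [CommRing A] : Finset A ⥤ CommRingCat.{u} where
  obj s := CommRingCat.of (Algebra.adjoin ℤ (s : Set A))
  map g := CommRingCat.ofHom
    (Subalgebra.inclusion (Algebra.adjoin_mono (Finset.coe_subset.mpr g.le))).toRingHom
  map_id _ := rfl
  map_comp _ _ := rfl

noncomputable def adjCocone (A : Type u) [CommRing A] : Cocone (adjF A) where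
  pt := CommRingCat.of A
  ι :=
    { app s := CommRingCat.ofHom (Algebra.adjoin ℤ (s : Set A)).val.toRingHom
      naturality _ _ _ := rfl }

noncomputable def adjIsColimit (A : Type u) [CommRing A] : IsColimit (adjCocone A) := by
  have := reflectsColimit_of_reflectsIsomorphisms (adjF A) (forget CommRingCat)
  refine isColimitOfReflects (forget CommRingCat) ?_
  refine Types.FilteredColimit.isColimitOf' (F := adjF A ⋙ forget CommRingCat) _ ?_ ?_
  · intro (a : A)
    refine ⟨{a}, (⟨a, Algebra.subset_adjoin (by simp)⟩ : Algebra.adjoin ℤ (({a} : Finset A) : Set A)), rfl⟩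
  · intro i x y hxy
    exact ⟨i, 𝟙 _, congrArg _ (Subtype.ext hxy)⟩

noncomputable abbrev adjD (A : Type u) [CommRing A] : (Finset A)ᵒᵖ ⥤ Scheme.{u} :=
  (adjF A).op ⋙ Scheme.Spec

noncomputable abbrev adjC (A : Type u) [CommRing A] : Cone (adjD A) :=
  Scheme.Spec.mapCone (adjCocone A).op

noncomputable def adjIsLimit (A : Type u) [CommRing A] : IsLimit (adjC A) :=
  isLimitOfPreserves Scheme.Spec (adjIsColimit A).op

instance (A : Type u) [CommRing A] (i) : IsAffine ((adjD A).obj i) :=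
  inferInstanceAs (IsAffine (Spec _))

instance adjNoeth (A : Type u) [CommRing A] (i) : IsLocallyNoetherian ((adjD A).obj i) := by
  have : IsNoetherianRing (Algebra.adjoin ℤ (i.unop : Set A)) :=
    haveI : Algebra.FiniteType ℤ (Algebra.adjoin ℤ (i.unop : Set A)) :=
      .adjoin_of_finite (Finset.finite_toSet _)
    Algebra.FiniteType.isNoetherianRing ℤ _
  have : IsNoetherianRing ((adjF A).obj i.unop) := this
  exact inferInstanceAs (IsLocallyNoetherian (Spec ((adjF A).obj i.unop)))

lemma algebra_model (A B : Type u) [CommRing A] [CommRing B] [Algebra A B]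
    [Algebra.FinitePresentation A B] :
    ∃ (s : Finset A) (B₀ : CommRingCat.{u}) (φ₀ : CommRingCat.of (Algebra.adjoin ℤ (s : Set A)) ⟶ B₀)
      (ψ : B₀ ⟶ CommRingCat.of B), φ₀.hom.FinitePresentation ∧
      IsPushout (CommRingCat.ofHom (Algebra.adjoin ℤ (s : Set A)).val.toRingHom) φ₀
        (CommRingCat.ofHom (algebraMap A B)) ψ := by
  obtain ⟨n, m, ⟨P⟩⟩ := Algebra.Presentation.exists_presentation_fin A B
  let s : Finset A := P.finite_coeffs.toFinset
  have : P.HasCoeffs (Algebra.adjoin ℤ (s : Set A)) :=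
    ⟨fun x hx => ⟨⟨x, Algebra.subset_adjoin (by simpa [s] using hx)⟩, rfl⟩⟩
  refine ⟨s, .of (P.ModelOfHasCoeffs (Algebra.adjoin ℤ (s : Set A))),
    CommRingCat.ofHom (algebraMap (Algebra.adjoin ℤ (s : Set A)) _),
    CommRingCat.ofHom ((P.tensorModelOfHasCoeffsEquiv
      (Algebra.adjoin ℤ (s : Set A))).toRingEquiv.toRingHom.comp
        (Algebra.TensorProduct.includeRight :
          P.ModelOfHasCoeffs (Algebra.adjoin ℤ (s : Set A)) →ₐ[Algebra.adjoin ℤ (s : Set A)]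
            TensorProduct (Algebra.adjoin ℤ (s : Set A)) A _).toRingHom), ?_, ?_⟩
  · exact RingHom.finitePresentation_algebraMap.mpr inferInstance
  · have h1 := CommRingCat.isPushout_tensorProduct (Algebra.adjoin ℤ (s : Set A)) A
      (P.ModelOfHasCoeffs (Algebra.adjoin ℤ (s : Set A)))
    refine h1.of_iso (Iso.refl _) (Iso.refl _) (Iso.refl _)
      ((P.tensorModelOfHasCoeffsEquiv
        (Algebra.adjoin ℤ (s : Set A))).toRingEquiv.toCommRingCatIso) ?_ ?_ ?_ ?_
    · rfl
    · rfl
    · ext x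
      exact (P.tensorModelOfHasCoeffsEquiv (Algebra.adjoin ℤ (s : Set A))).commutes x
    · rfl

lemma hasModel_affine (A : Type u) [CommRing A] {Y : Scheme.{u}} [IsAffine Y]
    (f : Y ⟶ (adjC A).pt) [hf : LocallyOfFinitePresentation f] : HasModel (adjC A) f := by
  obtain ⟨φ, hφ⟩ : ∃ φ : CommRingCat.of A ⟶ Γ(Y, ⊤), Spec.map φ = Y.isoSpec.inv ≫ f :=
    ⟨Spec.preimage (Y.isoSpec.inv ≫ f : Spec _ ⟶ Spec _), Spec.map_preimage _⟩
  have hφ' : φ.hom.FinitePresentation := by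
    have : LocallyOfFinitePresentation (Spec.map φ) := by
      rw [hφ]
      exact @locallyOfFinitePresentation_comp _ _ (adjC A).pt Y.isoSpec.inv f inferInstance hf
    exact (LocallyOfFinitePresentation.SpecMap_iff _).mp this
  let _ : Algebra A Γ(Y, ⊤) := φ.hom.toAlgebra
  have : Algebra.FinitePresentation A Γ(Y, ⊤) := hφ'
  obtain ⟨s, B₀, φ₀, ψ, h1, h2⟩ := algebra_model A Γ(Y, ⊤)
  have h3 := (isPullback_SpecMap_of_isPushout _ _ _ _ h2).flip
  have h4 : IsPullback (Spec.map ψ) (Spec.map φ) (Spec.map φ₀)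
    (Spec.map (CommRingCat.ofHom (Algebra.adjoin ℤ (s : Set A)).val.toRingHom)) := h3
  refine ⟨Opposite.op s, Spec B₀, Spec.map φ₀,
    Y.isoSpec.hom ≫ Spec.map ψ, ?_, ?_, ?_⟩
  · exact (LocallyOfFinitePresentation.SpecMap_iff _).mpr h1
  · exact inferInstanceAs (QuasiCompact (Spec.map φ₀))
  · have h5 : IsPullback (Y.isoSpec.hom ≫ Spec.map ψ) (Y.isoSpec.hom ≫ Spec.map φ) (Spec.map φ₀)
        (Spec.map (CommRingCat.ofHom (Algebra.adjoin ℤ (s : Set A)).val.toRingHom)) :=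
      h4.of_iso Y.isoSpec.symm (Iso.refl _) (Iso.refl _) (Iso.refl _)
        (by simp) (by simp) (by simp) (by simp)
    rw [hφ] at h5
    have h6 : Y.isoSpec.hom ≫ Y.isoSpec.inv ≫ f = f := Iso.hom_inv_id_assoc _ _
    rw [← h6]
    exact h5

lemma hasModel_of_qcqs (A : Type u) [CommRing A] {X : Scheme.{u}} [CompactSpace X]
    [QuasiSeparatedSpace X]
    (f : X ⟶ (adjC A).pt) [LocallyOfFinitePresentation f] : HasModel (adjC A) f := by
  have key : ∀ U : X.Opens, IsCompact (U : Set X) → HasModel (adjC A) (U.ι ≫ f) := by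
    intro U hU
    refine compact_open_induction_on (P := fun U => HasModel (adjC A) (U.ι ≫ f)) U hU ?_ ?_
    · have : IsAffine ((⊥ : X.Opens) : Scheme.{u}) := isAffineOpen_bot X
      exact hasModel_affine A _
    · intro T hT U hTm
      have : IsAffine (U.1 : Scheme.{u}) := U.2
      have : CompactSpace ((T ⊓ U.1 : X.Opens) : Scheme.{u}) := by
        refine isCompact_iff_compactSpace.mp ?_
        exact QuasiSeparatedSpace.inter_isCompact _ _ T.2 hT U.1.2 U.2.isCompact
      refine HasModel.glue (adjIsLimit A) (X.homOfLE (le_sup_left : T ≤ T ⊔ U.1))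
        (X.homOfLE (le_sup_right : U.1 ≤ T ⊔ U.1)) ?_ _ (X.homOfLE inf_le_left)
        (X.homOfLE inf_le_right) (isPullback_opens_inf_le _ _) ?_ ?_
      · rintro ⟨x, hx | hx⟩
        · exact .inl ⟨⟨x, hx⟩, by apply Subtype.ext; simp⟩
        · exact .inr ⟨⟨x, hx⟩, by apply Subtype.ext; simp⟩
      · simpa using hTm
      · simpa using hasModel_affine A (U.1.ι ≫ f)
  obtain ⟨i, P, p, h, h1, h2, h3⟩ := key ⊤ isCompact_univ
  refine ⟨i, P, p, X.topIso.inv ≫ h, h1, h2, ?_⟩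
  refine h3.of_iso X.topIso (Iso.refl _) (Iso.refl _) (Iso.refl _) ?_ ?_ ?_ ?_ <;> simp
end

/-- Let `S` be an affine scheme, `n ≥ 1`, and `X ⟶ S` a
morphism of finite presentation of type (FA)ₙ.  Then there is a scheme `S₀` of
finite type over `Spec ℤ`, a morphism `S ⟶ S₀` and an `S₀`-scheme `X₀` of
finite presentation of type (FA)ₙ over `S₀`, with `X ≅ X₀ ×_{S₀} S` as
`S`-schemes. -/
theorem stmt14 (n : ℕ) (hn : 1 ≤ n) {X S : Scheme.{u}} [IsAffine S]
    (f : X ⟶ S) [LocallyOfFinitePresentation f] [QuasiCompact f] [QuasiSeparated f]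
    (hFA : IsFA n f) :
    ∃ (S₀ X₀ : Scheme.{u}) (f₀ : X₀ ⟶ S₀) (g : S ⟶ S₀)
      (t : S₀ ⟶ Spec (CommRingCat.of (ULift.{u} ℤ))),
      LocallyOfFiniteType t ∧ QuasiCompact t ∧
      LocallyOfFinitePresentation f₀ ∧ QuasiCompact f₀ ∧ QuasiSeparated f₀ ∧
      IsFA n f₀ ∧
      ∃ e : X ≅ pullback f₀ g, e.hom ≫ pullback.snd f₀ g = f := by
  have hX1 : CompactSpace X := (quasiCompact_iff_compactSpace f).mp inferInstance
  have hX2 : QuasiSeparatedSpace X := (quasiSeparated_iff_quasiSeparatedSpace f).mp inferInstance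
  let A : Type u := Γ(S, ⊤)
  let σ : S ≅ (adjC A).pt := S.isoSpec
  have hf' : LocallyOfFinitePresentation (f ≫ σ.hom) := inferInstance
  obtain ⟨i, P, p, h, hp1, hp2, H⟩ := hasModel_of_qcqs A (f ≫ σ.hom)
  have hp3 : QuasiSeparated p := qs_of_noeth p
  have hX : FAspace n X := fun pts => hFA pts ⟨⊤, isAffineOpen_top S, fun _ => trivial⟩
  obtain ⟨j, hj⟩ := exists_faspace_of_isLimit (bcDiag p) (bcCone H) (bcIsLimit (adjIsLimit A) H) n hn hX
  have hpb : IsPullback (bcπ H j) f (bcF p j) (σ.hom ≫ (adjC A).π.app j.left) :=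
    (bcπ_isPullback H j).of_iso (Iso.refl _) (Iso.refl _) σ.symm (Iso.refl _)
      (by simp) (by simp) (by simp) (by simp)
  let s : Finset A := j.left.unop
  let τ : ULift.{u} ℤ →+* Algebra.adjoin ℤ (s : Set A) :=
    (algebraMap ℤ (Algebra.adjoin ℤ (s : Set A))).comp ULift.ringEquiv.toRingHom
  have hτ : τ.FiniteType := by
    have h1 : Algebra.FiniteType ℤ (Algebra.adjoin ℤ (s : Set A)) :=
      .adjoin_of_finite (Finset.finite_toSet _)
    exact RingHom.FiniteType.comp (RingHom.finiteType_algebraMap.mpr h1)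
      (RingHom.FiniteType.of_surjective _ ULift.ringEquiv.surjective)
  refine ⟨(adjD A).obj j.left, (bcDiag p).obj j, bcF p j, σ.hom ≫ (adjC A).π.app j.left,
    Spec.map (CommRingCat.ofHom τ), ?_, ?_, inferInstance, inferInstance, inferInstance, ?_, ?_⟩
  · exact HasRingHomProperty.Spec_iff.mpr hτ
  · exact inferInstanceAs (QuasiCompact (Spec.map (CommRingCat.ofHom τ)))
  · intro pts _
    exact hj pts
  · exact ⟨hpb.isoPullback, hpb.isoPullback_hom_snd⟩
end

section
/- (Eisenbud–Hochster) Let A be a noetherian commutative ring and P a prime ideal of A. Let 𝒩 be a set of maximal ideals m of A such that for every m ∈ 𝒩 one has P ⊆ m and the localization of A/P at m is a regular local ring, and such that ⋂_{m∈𝒩} m = P. Let M be a finitely generated A-module whose set of associated primes is {P}, and suppose P^e · M = 0 for some integer e ≥ 1. Then ⋂_{m∈𝒩} m^e·M = 0. -/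
open IsLocalRing

/-- A commutative ring is a regular local ring if it is a noetherian local ring
whose maximal ideal is generated by (Krull-)dimension many elements. -/
def IsRegularLocal (B : Type*) [CommRing B] : Prop :=
  IsNoetherianRing B ∧ ∃ _h : IsLocalRing B, ∃ s : Finset B,
    Ideal.span (s : Set B) = maximalIdeal B ∧
      (s.card : WithBot ℕ∞) = ringKrullDim B


theorem EH.quot_regular {B : Type*} [CommRing B] [IsLocalRing B] [IsNoetherianRing B]
    (s t : Finset B) (h : Ideal.span (s : Set B) ⊔ Ideal.span (t : Set B) = maximalIdeal B)
    (hd : ((s.card + t.card : ℕ) : WithBot ℕ∞) ≤ ringKrullDim B) :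
    ∃ _ : IsRegularLocalRing (B ⧸ Ideal.span (s : Set B)),
      (maximalIdeal (B ⧸ Ideal.span (s : Set B))).spanFinrank ≤ t.card := by
  have hs : Ideal.span (s : Set B) ≤ maximalIdeal B := h ▸ le_sup_left
  have hne : Ideal.span (s : Set B) ≠ ⊤ := fun h' =>
    (maximalIdeal.isMaximal B).ne_top (top_le_iff.mp (h' ▸ hs))
  have : Nontrivial (B ⧸ Ideal.span (s : Set B)) := Submodule.Quotient.nontrivial_iff.mpr hne
  have hsurj := Ideal.Quotient.mk_surjective (I := Ideal.span (s : Set B))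
  have : IsLocalRing (B ⧸ Ideal.span (s : Set B)) := IsLocalRing.of_surjective' _ hsurj
  have h1 := ringKrullDim_le_ringKrullDim_quotient_add_card s (by
    rw [ringJacobson_eq_maximalIdeal]
    exact fun x hx => hs (Ideal.subset_span hx))
  have h2 : maximalIdeal (B ⧸ Ideal.span (s : Set B)) =
      Ideal.span (Ideal.Quotient.mk (Ideal.span (s : Set B)) '' t) := by
    rw [← IsLocalRing.map_maximalIdeal_of_surjective _ hsurj, ← h, Ideal.map_sup,
      Ideal.map_quotient_self, bot_sup_eq, Ideal.map_span]
  have h3 : (maximalIdeal (B ⧸ Ideal.span (s : Set B))).spanFinrank ≤ t.card := by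
    rw [h2]
    refine (Submodule.spanFinrank_span_le_ncard_of_finite ((t.finite_toSet).image _)).trans ?_
    refine (Set.ncard_image_le t.finite_toSet).trans ?_
    simp
  have h4 := hd.trans h1
  have h5 : (t.card : WithBot ℕ∞) ≤ ringKrullDim (B ⧸ Ideal.span (s : Set B)) := by
    have h0 := ringKrullDim_nonneg_of_nontrivial (R := B ⧸ Ideal.span (s : Set B))
    generalize ringKrullDim (B ⧸ Ideal.span (s : Set B)) = D at *
    induction D using WithBot.recBotCoe with
    | bot => simp at h0
    | coe D =>
      rcases eq_or_ne D ⊤ with rfl | hD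
      · exact WithBot.coe_le_coe.mpr le_top
      · lift D to ℕ using hD
        norm_cast at h4 ⊢
        have : s.card + t.card ≤ D + s.card := by exact_mod_cast h4
        have : t.card ≤ D := by omega
        exact_mod_cast this
  exact ⟨IsRegularLocalRing.of_spanFinrank_maximalIdeal_le _
    (le_trans (by exact_mod_cast h3) h5), h3⟩

theorem EH.isDomain (d : ℕ) : ∀ {B : Type*} [CommRing B] [IsRegularLocalRing B],
    (maximalIdeal B).spanFinrank ≤ d → IsDomain B := by
  induction d with
  | zero =>
    intro B _ _ h
    rw [Nat.le_zero, Submodule.spanFinrank_eq_zero_iff_eq_bot (IsNoetherian.noetherian _)] at h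
    exact ((isField_iff_maximalIdeal_eq).mpr h).isDomain
  | succ d ih =>
    intro B _ _ hle
    classical
    by_cases hle' : (maximalIdeal B).spanFinrank ≤ d
    · exact ih hle'
    have h : (maximalIdeal B).spanFinrank = d + 1 := by omega
    have hdim : ringKrullDim B = ((d + 1 : ℕ) : WithBot ℕ∞) := by
      rw [← h, IsRegularLocalRing.spanFinrank_maximalIdeal]
    obtain ⟨s, hs, hspan⟩ := (IsNoetherian.noetherian
      (maximalIdeal B)).exists_span_finset_card_eq_spanFinrank
    have key : ∃ x ∈ maximalIdeal B, x ∉ maximalIdeal B ^ 2 ∧ ∀ q ∈ minimalPrimes B, x ∉ q := by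
      by_contra! hcon
      have hfin := minimalPrimes.finite_of_isNoetherianRing B
      have hsub : (maximalIdeal B : Set B) ⊆
          ⋃ i ∈ ((insert (maximalIdeal B ^ 2) hfin.toFinset : Finset (Ideal B)) : Set (Ideal B)),
            ((id i : Ideal B) : Set B) := by
        intro x hx
        by_cases hx2 : x ∈ maximalIdeal B ^ 2
        · simp only [Set.mem_iUnion]
          exact ⟨_, by simp, hx2⟩
        · obtain ⟨q, hq, hxq⟩ := hcon x hx hx2
          simp only [Set.mem_iUnion]
          exact ⟨q, by simp [hq], hxq⟩
      rw [Ideal.subset_union_prime (maximalIdeal B ^ 2) (maximalIdeal B ^ 2)] at hsub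
      · obtain ⟨i, hi, hle⟩ := hsub
        rw [Finset.mem_insert] at hi
        rcases hi with rfl | hi
        · have : maximalIdeal B = ⊥ := by
            apply Submodule.eq_bot_of_le_smul_of_le_jacobson_bot (maximalIdeal B) _
              (IsNoetherian.noetherian _)
            · simpa [pow_two] using hle
            · rw [IsLocalRing.jacobson_eq_maximalIdeal _ bot_ne_top]
          rw [this] at h
          simp at h
        · have hi' : i ∈ minimalPrimes B := by simpa using hi
          have hp : i.IsPrime := hi'.1.1
          have heq : maximalIdeal B = i := le_antisymm hle (le_maximalIdeal hp.ne_top)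
          have h0 : (maximalIdeal B).height = 0 := by
            rw [heq]
            exact Ideal.height_eq_zero_iff.mpr hi'
          have := maximalIdeal_height_eq_ringKrullDim (R := B)
          rw [h0, hdim] at this
          have h9 : ((0 : ℕ) : WithBot ℕ∞) = ((d + 1 : ℕ) : WithBot ℕ∞) := by simpa using this
          have : 0 = d + 1 := by exact_mod_cast h9
          omega
      · intro i hi h1 _
        simp only [Finset.mem_insert, h1, false_or, Set.Finite.mem_toFinset] at hi
        exact hi.1.1
    obtain ⟨x, hx, hx2, hxq⟩ := key
    have hx' := hx
    rw [← hspan, Submodule.mem_span_finset] at hx'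
    obtain ⟨f, -, hf⟩ := hx'
    obtain ⟨a, ha, hfa⟩ : ∃ a ∈ s, f a ∉ maximalIdeal B := by
      by_contra! hcon
      apply hx2
      rw [← hf, pow_two]
      refine Ideal.sum_mem _ fun a ha => Ideal.mul_mem_mul (hcon a ha) ?_
      rw [← hspan]
      exact Submodule.subset_span ha
    have hu : IsUnit (f a) := by simpa using hfa
    obtain ⟨hreg, hrk⟩ : ∃ _ : IsRegularLocalRing (B ⧸ Ideal.span ((({x} : Finset B)) : Set B)),
        (maximalIdeal (B ⧸ Ideal.span ((({x} : Finset B)) : Set B))).spanFinrank ≤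
          (s.erase a).card := by
      apply EH.quot_regular {x} (s.erase a)
      · apply le_antisymm
        · rw [sup_le_iff, Ideal.span_le, Ideal.span_le]
          refine ⟨by simpa using hx, fun y hy => ?_⟩
          rw [← hspan]
          exact Submodule.subset_span (Finset.mem_of_mem_erase hy)
        · conv_lhs => rw [← hspan]
          rw [Submodule.span_le]
          intro y hy
          by_cases hya : y = a
          · subst hya
            rw [← Finset.add_sum_erase _ _ hy] at hf
            have h6 : f y * y = x - ∑ z ∈ s.erase y, f z • z := by
              rw [← hf]; simp
            have h7 : f y * y ∈ Ideal.span (({x} : Finset B) : Set B) ⊔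
                Ideal.span ((s.erase y : Finset B) : Set B) := by
              rw [h6]
              apply Ideal.sub_mem
              · exact Ideal.mem_sup_left (Ideal.subset_span (by simp))
              · refine Ideal.sum_mem _ fun z hz => Ideal.mul_mem_left _ _
                  (Ideal.mem_sup_right (Ideal.subset_span hz))
            exact (Ideal.unit_mul_mem_iff_mem _ hu).mp h7
          · exact Ideal.mem_sup_right (Ideal.subset_span (by simpa [hya] using hy))
      · rw [hdim, Finset.card_singleton, Finset.card_erase_of_mem ha, hs, h]
        simp [add_comm]
    have hdom := ih (hrk.trans (by rw [Finset.card_erase_of_mem ha, hs, h]; simp))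
    have hprime : (Ideal.span ((({x} : Finset B)) : Set B)).IsPrime :=
      (Ideal.Quotient.isDomain_iff_prime _).mp hdom
    obtain ⟨q, hq, hqle⟩ := Ideal.exists_minimalPrimes_le
      (bot_le : ⊥ ≤ Ideal.span ((({x} : Finset B)) : Set B))
    have hqp : q.IsPrime := hq.1.1
    have hq0 : q = ⊥ := by
      apply Submodule.eq_bot_of_le_smul_of_le_jacobson_bot (maximalIdeal B) _
        (IsNoetherian.noetherian _)
      · intro y hy
        have hy' := hqle hy
        rw [Finset.coe_singleton, Ideal.mem_span_singleton'] at hy'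
        obtain ⟨b, rfl⟩ := hy'
        have hb : b ∈ q := (hqp.mem_or_mem hy).resolve_right (hxq q hq)
        rw [mul_comm]
        exact Ideal.mul_mem_mul hx hb
      · rw [IsLocalRing.jacobson_eq_maximalIdeal _ bot_ne_top]
    rw [hq0] at hqp
    exact IsDomain.of_bot_isPrime B

/-- Prefixes of a regular system of parameters generate prime ideals. -/
theorem EH.prefix_regular {B : Type*} [CommRing B] [IsLocalRing B] [IsNoetherianRing B]
    (l₁ : List B) (x : B) (l₂ : List B)
    (h : Ideal.ofList (l₁ ++ x :: l₂) = maximalIdeal B)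
    (hd : ((l₁ ++ x :: l₂).length : WithBot ℕ∞) = ringKrullDim B) (b : B)
    (hb : x * b ∈ Ideal.ofList l₁) : b ∈ Ideal.ofList l₁ := by
  classical
  have e1 : ∀ l : List B, Ideal.ofList l = Ideal.span ((l.toFinset : Finset B) : Set B) := by
    intro l; simp [Ideal.ofList]
  have hprime : (Ideal.ofList l₁).IsPrime := by
    have hq := EH.quot_regular l₁.toFinset (x :: l₂).toFinset
      (by rw [← e1, ← e1, ← Ideal.ofList_append, h]) (by
        rw [← hd]
        have h1 := l₁.toFinset_card_le
        have h2 := (x :: l₂).toFinset_card_le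
        have : l₁.toFinset.card + (x :: l₂).toFinset.card ≤ (l₁ ++ x :: l₂).length := by
          rw [List.length_append]; omega
        exact_mod_cast this)
    obtain ⟨hr, -⟩ := hq
    rw [e1]
    exact (Ideal.Quotient.isDomain_iff_prime _).mp (EH.isDomain _ le_rfl)
  refine (hprime.mem_or_mem hb).resolve_left fun hx => ?_
  have h1 : Ideal.ofList (l₁ ++ l₂) = maximalIdeal B := by
    rw [← h, Ideal.ofList_append, Ideal.ofList_append, Ideal.ofList_cons, ← sup_assoc]
    congr 1
    exact (sup_eq_left.mpr ((Ideal.span_singleton_le_iff_mem _).mpr hx)).symm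
  have h2 : (maximalIdeal B).spanFinrank ≤ (l₁ ++ l₂).length := by
    rw [← h1, e1]
    refine (Submodule.spanFinrank_span_le_ncard_of_finite (Finset.finite_toSet _)).trans ?_
    rw [Set.ncard_coe_finset]
    exact List.toFinset_card_le _
  have h3 := ringKrullDim_le_spanFinrank_maximalIdeal B
  rw [← hd] at h3
  have h4 : (l₁ ++ x :: l₂).length ≤ (maximalIdeal B).spanFinrank := by exact_mod_cast h3
  simp only [List.length_append, List.length_cons] at h2 h4
  omega
theorem EH.sup_pow_succ_le {A : Type*} [CommRing A] (I J : Ideal A) (k : ℕ) :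
    (I ⊔ J) ^ (k + 1) ≤ J ^ (k + 1) ⊔ I * (I ⊔ J) ^ k := by
  induction k with
  | zero => simp [sup_comm]
  | succ k ih =>
    rw [pow_succ' (I ⊔ J) (k + 1), Ideal.sup_mul, sup_le_iff]
    refine ⟨le_sup_right, (Ideal.mul_mono_right ih).trans ?_⟩
    rw [Ideal.mul_sup, sup_le_iff]
    refine ⟨?_, ?_⟩
    · rw [← pow_succ']; exact le_sup_left
    · refine le_trans ?_ le_sup_right
      rw [mul_left_comm, pow_succ' (I ⊔ J) k]
      exact Ideal.mul_mono_right (Ideal.mul_mono_left le_sup_right)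

/-- The list `l` is weakly regular on `N₀ / N₁` up to multiplication by elements of `S`. -/
def EH.WReg {A M : Type*} [CommRing A] [AddCommGroup M] [Module A M] (S : Submonoid A)
    (N₀ N₁ : Submodule A M) (l : List A) : Prop :=
  ∀ l₁ x l₂, l = l₁ ++ x :: l₂ → ∀ z ∈ N₀, x • z ∈ N₁ ⊔ Ideal.ofList l₁ • N₀ →
    ∃ s ∈ S, s • z ∈ N₁ ⊔ Ideal.ofList l₁ • N₀

theorem EH.core {A M : Type*} [CommRing A] [AddCommGroup M] [Module A M] (S : Submonoid A)
    (N₀ : Submodule A M) (l : List A) : ∀ N₁ ≤ N₀, EH.WReg S N₀ N₁ l → ∀ k : ℕ,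
      ∀ y ∈ Ideal.ofList l ^ k • N₀, y ∈ N₁ → ∃ s ∈ S, s • y ∈ Ideal.ofList l ^ k • N₁ := by
  induction l with
  | nil =>
    intro N₁ _ _ k y hy hy1
    cases k with
    | zero => exact ⟨1, S.one_mem, by simpa using hy1⟩
    | succ k =>
      refine ⟨1, S.one_mem, ?_⟩
      have : y = 0 := by simpa [pow_succ] using hy
      simp [this]
  | cons x l ih =>
    intro N₁ hle hreg k
    have htail : EH.WReg S N₀ (N₁ ⊔ Ideal.span {x} • N₀) l := by
      intro l₁ x' l₂ hl z hz
      have := hreg (x :: l₁) x' l₂ (by rw [hl]; rfl) z hz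
      rwa [Ideal.ofList_cons, Submodule.sup_smul, ← sup_assoc] at this
    have hhead : ∀ z ∈ N₀, x • z ∈ N₁ → ∃ s ∈ S, s • z ∈ N₁ := by
      have := hreg [] x l rfl
      simpa using this
    have hle' : N₁ ⊔ Ideal.span {x} • N₀ ≤ N₀ := sup_le hle Submodule.smul_le_right
    have ih' := ih _ hle' htail
    induction k with
    | zero => exact fun y _ hy1 => ⟨1, S.one_mem, by simpa using hy1⟩
    | succ k ihk =>
      intro y hy hy1
      set Q := Ideal.ofList (x :: l) with hQ
      have hQc : Q = Ideal.span {x} ⊔ Ideal.ofList l := Ideal.ofList_cons x l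
      have hlQ : Ideal.ofList l ≤ Q := hQc ▸ le_sup_right
      have hxQ : Ideal.span {x} ≤ Q := hQc ▸ le_sup_left
      have h1 : y ∈ Ideal.ofList l ^ (k + 1) • N₀ ⊔ Ideal.span {x} • (Q ^ k • N₀) := by
        have h2 := EH.sup_pow_succ_le (Ideal.span {x}) (Ideal.ofList l) k
        rw [← hQc] at h2
        have h3 := Submodule.smul_mono_left (N := N₀) h2 hy
        rwa [Submodule.sup_smul, Submodule.mul_smul] at h3
      obtain ⟨y₂, hy₂, w, hw, rfl⟩ := Submodule.mem_sup.mp h1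
      rw [Submodule.ideal_span_singleton_smul, Submodule.mem_smul_pointwise_iff_exists] at hw
      obtain ⟨z, hz, rfl⟩ := hw
      have hzN : z ∈ N₀ := Submodule.smul_le_right hz
      have h4 : y₂ ∈ N₁ ⊔ Ideal.span {x} • N₀ := by
        have : y₂ = (y₂ + x • z) - x • z := by abel
        rw [this]
        refine Submodule.sub_mem _ (Submodule.mem_sup_left hy1) (Submodule.mem_sup_right ?_)
        exact Submodule.smul_mem_smul (Ideal.mem_span_singleton_self x) hzN
      obtain ⟨s, hs, hsy⟩ := ih' (k + 1) y₂ hy₂ h4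
      rw [Submodule.smul_sup] at hsy
      obtain ⟨n, hn, w, hw, hnw⟩ := Submodule.mem_sup.mp hsy
      have hw' : w ∈ Ideal.span {x} • (Q ^ k • N₀) := by
        rw [← Submodule.mul_smul, mul_comm, Submodule.mul_smul] at hw
        refine Submodule.smul_mono le_rfl ?_ hw
        refine Submodule.smul_mono_left ?_
        exact (Ideal.pow_right_mono hlQ _).trans (Ideal.pow_le_pow_right (Nat.le_succ k))
      rw [Submodule.ideal_span_singleton_smul, Submodule.mem_smul_pointwise_iff_exists] at hw'
      obtain ⟨z', hz', rfl⟩ := hw'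
      have hn' : n ∈ Q ^ (k + 1) • N₁ :=
        Submodule.smul_mono_left (Ideal.pow_right_mono hlQ _) hn
      have h5 : s • (y₂ + x • z) = n + x • (z' + s • z) := by
        rw [smul_add, ← hnw, smul_add, smul_comm s x z]; abel
      have hzz : z' + s • z ∈ Q ^ k • N₀ := Submodule.add_mem _ hz' (Submodule.smul_mem _ _ hz)
      have h6 : x • (z' + s • z) ∈ N₁ := by
        have : x • (z' + s • z) = s • (y₂ + x • z) - n := by rw [h5]; abel
        rw [this]
        exact Submodule.sub_mem _ (Submodule.smul_mem _ _ hy1) (Submodule.smul_le_right hn')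
      obtain ⟨s', hs', h7⟩ := hhead _ (Submodule.smul_le_right hzz) h6
      obtain ⟨s'', hs'', h8⟩ := ihk (s' • (z' + s • z)) (Submodule.smul_mem _ _ hzz) h7
      refine ⟨s'' * s' * s, S.mul_mem (S.mul_mem hs'' hs') hs, ?_⟩
      rw [mul_smul, h5, smul_add]
      refine Submodule.add_mem _ (Submodule.smul_mem _ _ hn') ?_
      have : (s'' * s') • x • (z' + s • z) = x • (s'' • s' • (z' + s • z)) := by
        rw [smul_comm, mul_smul]
      rw [this, pow_succ', Submodule.mul_smul]
      exact Submodule.smul_mem_smul (hxQ (Ideal.mem_span_singleton_self x)) h8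

/-- The local step. -/
theorem EH.local_step {A M : Type*} [CommRing A] [AddCommGroup M] [Module A M] (S : Submonoid A)
    (P : Ideal A) (l : List A) (j : ℕ)
    (hreg : EH.WReg S (P ^ j • (⊤ : Submodule A M)) (P ^ (j + 1) • (⊤ : Submodule A M)) l)
    (k : ℕ) (z : M) (hz : z ∈ (P ⊔ Ideal.ofList l) ^ (k + 1) • (P ^ j • (⊤ : Submodule A M)))
    (hz1 : z ∈ P ^ (j + 1) • (⊤ : Submodule A M)) :
    ∃ s ∈ S, s • z ∈ (P ⊔ Ideal.ofList l) ^ k • (P ^ (j + 1) • (⊤ : Submodule A M)) := by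
  have h1 := Submodule.smul_mono_left (N := P ^ j • (⊤ : Submodule A M))
    (EH.sup_pow_succ_le P (Ideal.ofList l) k) hz
  rw [Submodule.sup_smul, mul_comm P, Submodule.mul_smul, ← Submodule.mul_smul P, ← pow_succ'] at h1
  obtain ⟨y, hy, y', hy', rfl⟩ := Submodule.mem_sup.mp h1
  have hle : P ^ (j + 1) • (⊤ : Submodule A M) ≤ P ^ j • (⊤ : Submodule A M) :=
    Submodule.smul_mono_left (Ideal.pow_le_pow_right (Nat.le_succ j))
  have hy1 : y ∈ P ^ (j + 1) • (⊤ : Submodule A M) := by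
    have : y = (y + y') - y' := by abel
    rw [this]
    exact Submodule.sub_mem _ hz1 (Submodule.smul_le_right hy')
  obtain ⟨s, hs, hsy⟩ := EH.core S _ l _ hle hreg (k + 1) y hy hy1
  refine ⟨s, hs, ?_⟩
  rw [smul_add]
  refine Submodule.add_mem _ (Submodule.smul_mono_left ?_ hsy) (Submodule.smul_mem _ _ hy')
  exact (Ideal.pow_right_mono le_sup_right _).trans (Ideal.pow_le_pow_right (Nat.le_succ k))

theorem EH.local_thm {A M : Type*} [CommRing A] [AddCommGroup M] [Module A M]
    (P m : Ideal A) [hm : m.IsMaximal] (hPm : P ≤ m) (l : List A) (hl : Ideal.ofList l ≤ m)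
    (s₀ : A) (hs₀ : s₀ ∉ m) (hs₀m : ∀ a ∈ m, s₀ * a ∈ P ⊔ Ideal.ofList l) (i : ℕ)
    (hreg : ∀ j < i, EH.WReg m.primeCompl (P ^ j • (⊤ : Submodule A M))
      (P ^ (j + 1) • (⊤ : Submodule A M)) l)
    (z : M) (hz : z ∈ m ^ (i + 1) • (⊤ : Submodule A M)) (hz1 : z ∈ P ^ i • (⊤ : Submodule A M)) :
    z ∈ m • (P ^ i • (⊤ : Submodule A M)) := by
  have hQ : ∀ n : ℕ, ∀ a ∈ m ^ n, s₀ ^ n * a ∈ (P ⊔ Ideal.ofList l) ^ n := by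
    intro n
    induction n with
    | zero => simp
    | succ n ih =>
      intro a ha
      rw [pow_succ] at ha
      refine Submodule.mul_induction_on ha (fun u hu v hv => ?_) (fun u v hu hv => ?_)
      · have : s₀ ^ (n + 1) * (u * v) = (s₀ ^ n * u) * (s₀ * v) := by ring
        rw [this, pow_succ (P ⊔ _)]
        exact Ideal.mul_mem_mul (ih u hu) (hs₀m v hv)
      · rw [mul_add]; exact Ideal.add_mem _ hu hv
  have h0 : s₀ ^ (i + 1) • z ∈ (P ⊔ Ideal.ofList l) ^ (i + 1) • (⊤ : Submodule A M) := by
    refine Submodule.smul_induction_on hz (fun r hr n hn => ?_) (fun u v hu hv => ?_)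
    · rw [← mul_smul]
      exact Submodule.smul_mem_smul (hQ _ r hr) trivial
    · rw [smul_add]; exact Submodule.add_mem _ hu hv
  have h1 : ∀ j ≤ i, ∃ s ∈ m.primeCompl,
      s • z ∈ (P ⊔ Ideal.ofList l) ^ (i - j + 1) • (P ^ j • (⊤ : Submodule A M)) := by
    intro j
    induction j with
    | zero =>
      intro _
      exact ⟨s₀ ^ (i + 1), m.primeCompl.pow_mem hs₀ _, by simpa using h0⟩
    | succ j ih =>
      intro hj
      obtain ⟨s, hs, h2⟩ := ih (by omega)
      obtain ⟨s', hs', h3⟩ := EH.local_step m.primeCompl P l j (hreg j (by omega)) _ _ h2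
        (Submodule.smul_mem _ _ (Submodule.smul_mono_left (Ideal.pow_le_pow_right hj) hz1))
      refine ⟨s' * s, m.primeCompl.mul_mem hs' hs, ?_⟩
      rw [mul_smul]
      convert h3 using 3
      omega
  obtain ⟨s, hs, h2⟩ := h1 i le_rfl
  have h3 : s • z ∈ m • (P ^ i • (⊤ : Submodule A M)) := by
    refine Submodule.smul_mono_left ?_ h2
    simpa using ⟨hPm, hl⟩
  obtain ⟨a, b, hb, hab⟩ := hm.exists_inv hs
  have : z = a • (s • z) + b • z := by
    rw [← mul_smul, ← add_smul, hab, one_smul]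
  rw [this]
  exact Submodule.add_mem _ (Submodule.smul_mem _ _ h3) (Submodule.smul_mem_smul hb hz1)

/-- Finite modules over a domain are generically free. -/
theorem EH.generic_free {R G : Type*} [CommRing R] [IsDomain R] [AddCommGroup G] [Module R G]
    [Module.Finite R G] : ∃ f : R, f ≠ 0 ∧ ∃ s : Finset G, ∃ β : G →ₗ[R] (s → R),
      ∀ z, f • z = ∑ j, β z j • (j : G) := by
  obtain ⟨s, hs, hli⟩ := exists_set_linearIndependent R G
  have hfin : s.Finite := hli.setFinite
  obtain ⟨s, rfl⟩ := hfin.exists_finset_coe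
  have htor : ∀ z : G, ∃ a : R, a ≠ 0 ∧ a • z ∈ Submodule.span R (s : Set G) := by
    have h1 := rank_quotient_add_rank_of_isDomain (Submodule.span R (s : Set G))
    have h2 : Module.rank R (Submodule.span R (s : Set G)) = Module.rank R G := by
      rw [← hs]; exact rank_span_set hli
    rw [h2] at h1
    have hlt : Module.rank R G < Cardinal.aleph0 := Module.rank_lt_aleph0 R G
    have h3 : Module.rank R (G ⧸ Submodule.span R (s : Set G)) = 0 := by
      have : Module.rank R (G ⧸ Submodule.span R (s : Set G)) + Module.rank R G =
        0 + Module.rank R G := by rw [h1, zero_add]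
      exact Cardinal.eq_of_add_eq_add_right this hlt
    rw [rank_eq_zero_iff] at h3
    intro z
    obtain ⟨a, ha, h4⟩ := h3 (Submodule.Quotient.mk z)
    exact ⟨a, ha, by rwa [← Submodule.Quotient.mk_smul, Submodule.Quotient.mk_eq_zero] at h4⟩
  obtain ⟨t, ht⟩ := Module.Finite.fg_top (R := R) (M := G)
  choose c hc0 hc using htor
  have hf : ∀ z : G, (∏ g ∈ t, c g) • z ∈ Submodule.span R (s : Set G) := by
    intro z
    have hz : z ∈ Submodule.span R (t : Set G) := ht ▸ Submodule.mem_top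
    induction hz using Submodule.span_induction with
    | mem x hx =>
      classical
      rw [← Finset.prod_erase_mul _ _ hx, mul_smul]
      exact Submodule.smul_mem _ _ (hc x)
    | zero => simp
    | add x y _ _ hx hy => rw [smul_add]; exact Submodule.add_mem _ hx hy
    | smul a x _ hx => rw [smul_comm]; exact Submodule.smul_mem _ _ hx
  let b : Module.Basis s R (Submodule.span R (Set.range (Subtype.val : s → G))) :=
    Module.Basis.span hli
  have hf' : ∀ z : G, (∏ g ∈ t, c g) • z ∈
      Submodule.span R (Set.range (Subtype.val : s → G)) := by
    simpa using hf
  refine ⟨∏ g ∈ t, c g, Finset.prod_ne_zero_iff.mpr fun g _ => hc0 g, s,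
    b.equivFun.toLinearMap ∘ₗ ((LinearMap.lsmul R G (∏ g ∈ t, c g)).codRestrict _ hf'), ?_⟩
  intro z
  have h5 := congrArg Subtype.val (b.sum_equivFun ⟨_, hf' z⟩)
  simp only [AddSubmonoidClass.coe_finsetSum, Submodule.coe_smul] at h5
  conv_lhs => rw [← h5]
  refine Finset.sum_congr rfl fun j _ => ?_
  have : ((b j : _) : G) = j := by simp [b, Module.Basis.span_apply]
  rw [this]
  rfl

/-- Generic freeness for `N₀ / N₁`, in terms of elements. -/
theorem EH.generic {A M : Type*} [CommRing A] [IsNoetherianRing A] [AddCommGroup M] [Module A M]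
    [Module.Finite A M] (P : Ideal A) [P.IsPrime] (N₀ N₁ : Submodule A M) (hP : P • N₀ ≤ N₁) :
    ∃ f : A, f ∉ P ∧ ∃ (n : ℕ) (g : Fin n → M) (β : N₀ →ₗ[A] (Fin n → A ⧸ P)),
      (∀ j, g j ∈ N₀) ∧ (∀ z : N₀, (z : M) ∈ N₁ → β z = 0) ∧
      ∀ (z : N₀) (a : Fin n → A), (∀ j, Ideal.Quotient.mk P (a j) = β z j) →
        f • (z : M) - ∑ j, a j • g j ∈ N₁ := by
  let N := N₁.comap N₀.subtype
  have htor : Module.IsTorsionBySet A (N₀ ⧸ N) P := by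
    rintro x ⟨a, ha⟩
    obtain ⟨z, rfl⟩ := Submodule.Quotient.mk_surjective _ x
    change a • Submodule.Quotient.mk z = 0
    rw [← Submodule.Quotient.mk_smul, Submodule.Quotient.mk_eq_zero]
    exact hP (Submodule.smul_mem_smul ha z.2)
  let _ : Module (A ⧸ P) (N₀ ⧸ N) := htor.module
  have : IsScalarTower A (A ⧸ P) (N₀ ⧸ N) := htor.isScalarTower
  have : Module.Finite (A ⧸ P) (N₀ ⧸ N) := Module.Finite.of_restrictScalars_finite A _ _
  obtain ⟨f, hf, s, β, hβ⟩ := EH.generic_free (R := A ⧸ P) (G := N₀ ⧸ N)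
  obtain ⟨f, rfl⟩ := Ideal.Quotient.mk_surjective f
  let e := s.equivFin
  have hg : ∀ x : N₀ ⧸ N, ∃ z : N₀, Submodule.Quotient.mk z = x := fun x =>
    Submodule.Quotient.mk_surjective _ x
  choose g hg using hg
  refine ⟨f, fun h => hf (Ideal.Quotient.eq_zero_iff_mem.mpr h), s.card,
    fun j => (g (e.symm j : N₀ ⧸ N) : M),
    (LinearMap.funLeft A (A ⧸ P) e.symm) ∘ₗ (β.restrictScalars A) ∘ₗ N.mkQ, ?_, ?_, ?_⟩
  · exact fun j => (g _).2
  · intro z hz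
    have : N.mkQ z = 0 := by simpa [N] using hz
    simp [this]
  · intro z a ha
    have h1 : f • z - ∑ j, a j • g (e.symm j : N₀ ⧸ N) ∈ N := by
      rw [← Submodule.Quotient.mk_eq_zero, Submodule.Quotient.mk_sub, sub_eq_zero,
        Submodule.Quotient.mk_smul]
      have h2 := hβ (Submodule.Quotient.mk z)
      have h3 : Ideal.Quotient.mk P f • (Submodule.Quotient.mk z : N₀ ⧸ N) =
        f • (Submodule.Quotient.mk z : N₀ ⧸ N) := algebraMap_smul (A ⧸ P) f _
      rw [← h3, h2, ← e.symm.sum_comp, ← Submodule.mkQ_apply N (∑ j, _), map_sum]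
      refine Finset.sum_congr rfl fun j _ => ?_
      rw [map_smul, Submodule.mkQ_apply, hg]
      have h4 : β (Submodule.Quotient.mk z) (e.symm j) = Ideal.Quotient.mk P (a j) := (ha j).symm
      rw [h4]
      exact algebraMap_smul (A ⧸ P) (a j) _
    have := h1
    simpa [N] using this

theorem EH.beta_mem {A M : Type*} [CommRing A] [AddCommGroup M] [Module A M]
    (P J : Ideal A) (N₀ N₁ : Submodule A M) (hle : N₁ ≤ N₀) {n : ℕ}
    (β : N₀ →ₗ[A] (Fin n → A ⧸ P)) (hβ : ∀ z : N₀, (z : M) ∈ N₁ → β z = 0)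
    (z : N₀) (hz : (z : M) ∈ N₁ ⊔ J • N₀) (j : Fin n) (a : A)
    (ha : Ideal.Quotient.mk P a = β z j) : a ∈ P ⊔ J := by
  let T : Submodule A M := Submodule.map N₀.subtype
    (Submodule.comap (LinearMap.proj j ∘ₗ β)
      (Submodule.map (Algebra.linearMap A (A ⧸ P)) J))
  have hT : N₁ ⊔ J • N₀ ≤ T := by
    refine sup_le (fun y hy => ?_) (Submodule.smul_le.mpr fun r hr y hy => ?_)
    · refine ⟨⟨y, hle hy⟩, ?_, rfl⟩
      exact ⟨0, J.zero_mem, by simp [hβ ⟨y, hle hy⟩ hy]⟩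
    · refine ⟨⟨r • y, Submodule.smul_mem _ _ hy⟩, ?_, rfl⟩
      obtain ⟨c, hc⟩ := Ideal.Quotient.mk_surjective (β ⟨y, hy⟩ j)
      refine ⟨r * c, Ideal.mul_mem_right _ _ hr, ?_⟩
      have : (⟨r • y, Submodule.smul_mem _ _ hy⟩ : N₀) = r • ⟨y, hy⟩ := rfl
      rw [this, map_smul]
      change Ideal.Quotient.mk P (r * c) = r • (β ⟨y, hy⟩ j)
      rw [← hc, Algebra.smul_def]
      simp
  obtain ⟨z', ⟨b, hb, hbz⟩, hz'⟩ := hT hz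
  have : z' = z := Subtype.ext hz'
  subst this
  have h1 : Ideal.Quotient.mk P b = Ideal.Quotient.mk P a := by rw [ha]; exact hbz
  rw [Ideal.Quotient.eq] at h1
  have : a = b - (b - a) := by ring
  rw [this]
  exact Ideal.sub_mem _ (Ideal.mem_sup_right hb) (Ideal.mem_sup_left h1)

theorem EH.transfer {A M : Type*} [CommRing A] [AddCommGroup M] [Module A M] (S : Submonoid A)
    (P : Ideal A) (N₀ N₁ : Submodule A M) (hle : N₁ ≤ N₀) (hP : P • N₀ ≤ N₁)
    (l : List A) (hl : ∀ l₁ x l₂, l = l₁ ++ x :: l₂ → ∀ a, x * a ∈ P ⊔ Ideal.ofList l₁ →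
      ∃ s ∈ S, s * a ∈ P ⊔ Ideal.ofList l₁)
    (f : A) (hf : f ∈ S) {n : ℕ} (g : Fin n → M) (hg : ∀ j, g j ∈ N₀)
    (β : N₀ →ₗ[A] (Fin n → A ⧸ P)) (hβ : ∀ z : N₀, (z : M) ∈ N₁ → β z = 0)
    (hfβ : ∀ (z : N₀) (a : Fin n → A), (∀ j, Ideal.Quotient.mk P (a j) = β z j) →
        f • (z : M) - ∑ j, a j • g j ∈ N₁) : EH.WReg S N₀ N₁ l := by
  intro l₁ x l₂ hl' z hz hxz
  have ha : ∀ j, ∃ a, Ideal.Quotient.mk P a = β ⟨z, hz⟩ j := fun j =>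
    Ideal.Quotient.mk_surjective _
  choose a ha using ha
  have h1 : ∀ j, x * a j ∈ P ⊔ Ideal.ofList l₁ := fun j => by
    refine EH.beta_mem P _ N₀ N₁ hle β hβ (x • ⟨z, hz⟩) hxz j _ ?_
    rw [map_smul, Pi.smul_apply, ← ha, map_mul, Algebra.smul_def]
    rfl
  choose s hs hsa using fun j => hl l₁ x l₂ hl' (a j) (h1 j)
  refine ⟨(∏ j, s j) * f, S.mul_mem (S.prod_mem fun j _ => hs j) hf, ?_⟩
  have h2 : ((∏ j, s j) * f) • z =
      (∏ j, s j) • (f • z - ∑ j, a j • g j) + ∑ j, ((∏ j, s j) * a j) • g j := by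
    rw [smul_sub, ← mul_smul, Finset.smul_sum]
    simp only [mul_smul]
    abel
  rw [h2]
  refine Submodule.add_mem _ (Submodule.mem_sup_left (Submodule.smul_mem _ _
    (hfβ ⟨z, hz⟩ a ha))) (Submodule.sum_mem _ fun j _ => ?_)
  have h3 : (∏ j, s j) * a j ∈ P ⊔ Ideal.ofList l₁ := by
    rw [← Finset.prod_erase_mul _ _ (Finset.mem_univ j), mul_assoc]
    exact Ideal.mul_mem_left _ _ (hsa j)
  have h4 := Submodule.smul_mem_smul h3 (hg j)
  rw [Submodule.sup_smul] at h4
  exact sup_le_sup_right hP _ h4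

theorem EH.params {A : Type*} [CommRing A] [IsNoetherianRing A] (P m : Ideal A) [m.IsPrime]
    (hPm : P ≤ m) (B : Type*) [CommRing B] [Algebra (A ⧸ P) B]
    [IsLocalization (Submonoid.map (Ideal.Quotient.mk P).toMonoidHom m.primeCompl) B]
    [IsLocalRing B] [IsNoetherianRing B] (t : Finset B)
    (ht : Ideal.span (t : Set B) = maximalIdeal B) (hd : (t.card : WithBot ℕ∞) = ringKrullDim B) :
    ∃ l : List A, Ideal.ofList l ≤ m ∧
      (∃ s₀ ∉ m, ∀ a ∈ m, s₀ * a ∈ P ⊔ Ideal.ofList l) ∧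
      ∀ l₁ x l₂, l = l₁ ++ x :: l₂ → ∀ a, x * a ∈ P ⊔ Ideal.ofList l₁ →
        ∃ s ∈ m.primeCompl, s * a ∈ P ⊔ Ideal.ofList l₁ := by
  let S' := Submonoid.map (Ideal.Quotient.mk P).toMonoidHom m.primeCompl
  let φ : A →+* B := (algebraMap (A ⧸ P) B).comp (Ideal.Quotient.mk P)
  have hφP : ∀ a ∈ P, φ a = 0 := fun a ha => by
    simp [φ, Ideal.Quotient.eq_zero_iff_mem.mpr ha]
  have hunit : ∀ s ∉ m, IsUnit (φ s) := fun s hs =>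
    IsLocalization.map_units B (⟨Ideal.Quotient.mk P s, s, hs, rfl⟩ : S')
  have hker : ∀ a, φ a = 0 → ∃ s ∈ m.primeCompl, s * a ∈ P := by
    intro a ha
    have h0 : algebraMap (A ⧸ P) B (Ideal.Quotient.mk P a) = 0 := ha
    rw [IsLocalization.map_eq_zero_iff S'] at h0
    obtain ⟨⟨_, s, hs, rfl⟩, h1⟩ := h0
    refine ⟨s, hs, ?_⟩
    rw [← Ideal.Quotient.eq_zero_iff_mem, map_mul]
    exact h1
  have hsurj : ∀ b : B, ∃ a, ∃ s ∈ m.primeCompl, b * φ s = φ a := by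
    intro b
    obtain ⟨⟨x, ⟨_, s, hs, rfl⟩⟩, h1⟩ := IsLocalization.surj S' b
    obtain ⟨a, rfl⟩ := Ideal.Quotient.mk_surjective x
    exact ⟨a, s, hs, h1⟩
  have hmem : ∀ (I : Ideal A) (a : A), φ a ∈ I.map φ → ∃ s ∈ m.primeCompl, s * a ∈ P ⊔ I := by
    intro I a ha
    have key : ∀ b ∈ I.map φ, ∃ c ∈ I, ∃ s ∈ m.primeCompl, b * φ s = φ c := by
      intro b hb
      refine Submodule.span_induction ?_ ?_ ?_ ?_ hb
      · rintro _ ⟨c, hc, rfl⟩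
        exact ⟨c, hc, 1, m.primeCompl.one_mem, by simp⟩
      · exact ⟨0, I.zero_mem, 1, m.primeCompl.one_mem, by simp⟩
      · rintro u v - - ⟨c, hc, s, hs, h1⟩ ⟨c', hc', s', hs', h2⟩
        refine ⟨s' * c + s * c', I.add_mem (I.mul_mem_left _ hc) (I.mul_mem_left _ hc'),
          s * s', m.primeCompl.mul_mem hs hs', ?_⟩
        rw [map_mul, map_add, map_mul, map_mul, ← h1, ← h2]; ring
      · rintro r u - ⟨c, hc, s, hs, h1⟩
        obtain ⟨a', s', hs', h2⟩ := hsurj r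
        refine ⟨a' * c, I.mul_mem_left _ hc, s' * s, m.primeCompl.mul_mem hs' hs, ?_⟩
        rw [map_mul, map_mul, ← h1, ← h2, smul_eq_mul]; ring
    obtain ⟨c, hc, s, hs, h1⟩ := key _ ha
    have h2 : φ (a * s - c) = 0 := by rw [map_sub, map_mul, h1, sub_self]
    obtain ⟨s', hs', h3⟩ := hker _ h2
    refine ⟨s' * s, m.primeCompl.mul_mem hs' hs, ?_⟩
    have : s' * s * a = s' * (a * s - c) + s' * c := by ring
    rw [this]
    exact Ideal.add_mem _ (Ideal.mem_sup_left h3) (Ideal.mem_sup_right (I.mul_mem_left _ hc))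
  have hmax : ∀ a ∈ m, φ a ∈ maximalIdeal B := by
    intro a ha
    rw [mem_maximalIdeal, mem_nonunits_iff]
    intro hu
    obtain ⟨s, hs, h1⟩ := hmem (Ideal.span {a}) 1 (by
      have h2 : φ a ∈ (Ideal.span {a}).map φ :=
        Ideal.mem_map_of_mem _ (Ideal.mem_span_singleton_self a)
      rw [Ideal.eq_top_of_isUnit_mem _ h2 hu]; trivial)
    rw [mul_one] at h1
    exact hs ((sup_le hPm ((Ideal.span_singleton_le_iff_mem _).mpr ha)) h1)
  choose c s hs hc using hsurj
  let l := t.toList.map c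
  have hlen : (l.map φ).length = t.card := by simp [l]
  have hspan : Ideal.ofList (l.map φ) = maximalIdeal B := by
    rw [← ht]
    apply le_antisymm
    · refine Ideal.span_le.mpr fun y hy => ?_
      obtain ⟨b, hb, rfl⟩ : ∃ b ∈ t, φ (c b) = y := by simpa [l] using hy
      rw [← hc]
      exact Ideal.mul_mem_right _ _ (Ideal.subset_span hb)
    · refine Ideal.span_le.mpr fun b hb => ?_
      have h1 : φ (c b) ∈ Ideal.ofList (l.map φ) := Ideal.subset_span (by
        simp only [l, List.map_map, Set.mem_ofPred_eq, List.mem_map, Finset.mem_toList]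
        exact ⟨b, hb, rfl⟩)
      rw [← hc] at h1
      exact (Ideal.mul_unit_mem_iff_mem _ (hunit _ (hs b))).mp h1
  refine ⟨l, ?_, ?_, ?_⟩
  · refine Ideal.span_le.mpr fun y hy => ?_
    by_contra hy'
    have h1 : φ y ∈ maximalIdeal B := by
      rw [← hspan]
      exact Ideal.subset_span (List.mem_map_of_mem hy)
    exact (mem_nonunits_iff.mp ((mem_maximalIdeal _).mp h1)) (hunit y hy')
  · have h1 : ∀ a : A, ∃ s ∉ m, a ∈ m → s * a ∈ P ⊔ Ideal.ofList l := by
      intro a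
      by_cases ha : a ∈ m
      · obtain ⟨s, hs, h2⟩ := hmem (Ideal.ofList l) a (by
          rw [Ideal.map_ofList, hspan]; exact hmax a ha)
        exact ⟨s, hs, fun _ => h2⟩
      · exact ⟨a, ha, fun h => absurd h ha⟩
    choose d hd0 hd using h1
    obtain ⟨u, hu⟩ := IsNoetherian.noetherian m
    refine ⟨∏ x ∈ u, d x, m.primeCompl.prod_mem fun x _ => hd0 x, fun a ha => ?_⟩
    rw [← hu] at ha
    induction ha using Submodule.span_induction with
    | mem x hx =>
      classical
      rw [← Finset.prod_erase_mul _ _ hx, mul_assoc]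
      refine Ideal.mul_mem_left _ _ (hd x ?_)
      rw [← hu]; exact Submodule.subset_span hx
    | zero => simp
    | add x y _ _ hx hy => rw [mul_add]; exact Ideal.add_mem _ hx hy
    | smul r x _ hx => rw [smul_eq_mul, mul_left_comm]; exact Ideal.mul_mem_left _ _ hx
  · intro l₁ x l₂ hl a ha
    apply hmem
    rw [Ideal.map_ofList]
    have hl' : l.map φ = l₁.map φ ++ φ x :: l₂.map φ := by rw [hl]; simp
    apply EH.prefix_regular (l₁.map φ) (φ x) (l₂.map φ)
    · rw [← hl', hspan]
    · rw [← hl', hlen, hd]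
    · rw [← map_mul, ← Ideal.map_ofList]
      have h1 := Ideal.mem_map_of_mem φ ha
      rw [Ideal.map_sup] at h1
      have h2 : P.map φ = ⊥ := by
        rw [eq_bot_iff, Ideal.map_le_iff_le_comap]
        exact fun a ha => hφP a ha
      rwa [h2, bot_sup_eq] at h1

/-- **Eisenbud–Hochster.** Let `A` be noetherian, `P` a prime
ideal, `𝒩` a set of maximal ideals `m ⊇ P` with `(A/P)_m` regular local and
`⋂_{m ∈ 𝒩} m = P`.  If `M` is a finitely generated `P`-coprimary module with
`P^e • M = 0`, then `⋂_{m ∈ 𝒩} m^e • M = 0`. -/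
theorem stmt15 {A : Type*} [CommRing A] [IsNoetherianRing A]
    (P : Ideal A) (hP : P.IsPrime)
    (𝒩 : Set (Ideal A)) (hmax : ∀ m ∈ 𝒩, m.IsMaximal) (hPle : ∀ m ∈ 𝒩, P ≤ m)
    (hreg : ∀ m (hm : m ∈ 𝒩),
      IsRegularLocal (Localization
        (Submonoid.map (Ideal.Quotient.mk P).toMonoidHom
          (@Ideal.primeCompl A _ m (hmax m hm).isPrime))))
    (hinter : sInf 𝒩 = P)
    {M : Type*} [AddCommGroup M] [Module A M] [Module.Finite A M]
    (hass : associatedPrimes A M = {P})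
    (e : ℕ) (he : 1 ≤ e) (hPe : (P ^ e) • (⊤ : Submodule A M) = ⊥) :
    (⨅ m ∈ 𝒩, (m ^ e) • (⊤ : Submodule A M)) = ⊥ := by
  have hle : ∀ j, P ^ (j + 1) • (⊤ : Submodule A M) ≤ P ^ j • (⊤ : Submodule A M) := fun j =>
    Submodule.smul_mono_left (Ideal.pow_le_pow_right (Nat.le_succ j))
  have hPj : ∀ j, P • (P ^ j • (⊤ : Submodule A M)) ≤ P ^ (j + 1) • (⊤ : Submodule A M) := by
    intro j
    rw [← Submodule.mul_smul, ← pow_succ']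
  choose f hfP n g β hg hβ hfβ using fun j : ℕ =>
    EH.generic P (P ^ j • (⊤ : Submodule A M)) (P ^ (j + 1) • (⊤ : Submodule A M)) (hPj j)
  let F := ∏ j ∈ Finset.range e, f j
  have hF : F ∉ P := P.primeCompl.prod_mem fun j _ => hfP j
  have hnzd : ∀ s ∉ P, ∀ y : M, s • y = 0 → y = 0 := by
    intro s hs y hy
    by_contra hy0
    have h1 : s ∈ {r : A | ∃ x : M, x ≠ 0 ∧ r • x = 0} := ⟨y, hy0, hy⟩
    rw [← biUnion_associatedPrimes_eq_zero_divisors, hass] at h1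
    exact hs (by simpa using h1)
  rw [eq_bot_iff]
  intro y hy
  simp only [Submodule.mem_iInf] at hy
  have key : ∀ i ≤ e, ∃ s ∉ P, s • y ∈ P ^ i • (⊤ : Submodule A M) := by
    intro i
    induction i with
    | zero => exact fun _ => ⟨1, P.primeCompl.one_mem, by simp⟩
    | succ i ih =>
      intro hi
      obtain ⟨s, hs, hz⟩ := ih (by omega)
      have hstep : ∀ m ∈ 𝒩, F ∉ m → s • y ∈ m • (P ^ i • (⊤ : Submodule A M)) := by
        intro m hm hFm
        have := hmax m hm
        obtain ⟨hnoeth, hloc, t, ht, hd⟩ := hreg m hm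
        obtain ⟨l, hl, ⟨s₀, hs₀, hs₀m⟩, hlreg⟩ := EH.params P m (hPle m hm)
          (Localization (Submonoid.map (Ideal.Quotient.mk P).toMonoidHom m.primeCompl)) t ht hd
        refine EH.local_thm P m (hPle m hm) l hl s₀ hs₀ hs₀m i (fun j hj => ?_) _
          (Submodule.smul_mem _ _ (Submodule.smul_mono_left (Ideal.pow_le_pow_right hi)
            (hy m hm))) hz
        refine EH.transfer m.primeCompl P _ _ (hle j) (hPj j) l hlreg (f j) (fun hfm => hFm ?_)
          (g j) (hg j) (β j) (hβ j) (hfβ j)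
        exact Ideal.mem_of_dvd _ (Finset.dvd_prod_of_mem f
          (Finset.mem_range.mpr (by omega : j < e))) hfm
      have ha : ∀ j, ∃ a, Ideal.Quotient.mk P a = β i ⟨s • y, hz⟩ j := fun j =>
        Ideal.Quotient.mk_surjective _
      choose a ha using ha
      have haP : ∀ j, a j ∈ P := by
        intro j
        refine (hP.mem_or_mem (?_ : F * a j ∈ P)).resolve_left hF
        rw [← hinter, Submodule.mem_sInf]
        intro m hm
        by_cases hFm : F ∈ m
        · exact Ideal.mul_mem_right _ _ hFm
        · refine Ideal.mul_mem_left _ _ ?_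
          have := EH.beta_mem P m _ _ (hle i) (β i) (hβ i) ⟨s • y, hz⟩
            (Submodule.mem_sup_right (hstep m hm hFm)) j (a j) (ha j)
          rwa [sup_eq_right.mpr (hPle m hm)] at this
      refine ⟨f i * s, P.primeCompl.mul_mem (hfP i) hs, ?_⟩
      have h1 := hfβ i ⟨s • y, hz⟩ a ha
      have h2 : ∑ j, a j • g i j ∈ P ^ (i + 1) • (⊤ : Submodule A M) :=
        Submodule.sum_mem _ fun j _ => hPj i (Submodule.smul_mem_smul (haP j) (hg i j))
      have h3 := Submodule.add_mem _ h1 h2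
      rw [sub_add_cancel] at h3
      rwa [mul_smul]
  obtain ⟨s, hs, h1⟩ := key e le_rfl
  rw [hPe, Submodule.mem_bot] at h1
  exact hnzd s hs y h1
end
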